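/- arXiv:2301.13847 — 2 statements merged into one kernel-verified Lean document; each statement's English description precedes it below -/
import Mathlib

section
/- The assignment w ↦ θ_w = {α ∈ Δ : wα > 0} is a bijection from the Bessel support B(SO_{2l}) (Weyl elements w such that every simple root is sent by w to a negative or simple root) onto the power set of the set of simple roots Δ(SO_{2l}). Moreover, for w, w' ∈ B(SO_{2l}), w' ≤ w in the Bruhat order if and only if θ_w ⊆ θ_{w'}. -/
noncomputable section

/-- The order-reversing involution `i ↦ 2l-1-i` of `Fin (2l)`. -/
def revF (l : ℕ) (i : Fin (2*l)) : Fin (2*l) :=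
  ⟨2*l-1-(i:ℕ), by have := i.isLt; omega⟩

/-- Membership in the Weyl group of type `D_l`, realized as the group of permutations of
`Fin (2l)` commuting with `rev` and with an even number of "sign changes". -/
def inWeylD (l : ℕ) (σ : Equiv.Perm (Fin (2*l))) : Prop :=
  (∀ i, σ (revF l i) = revF l (σ i)) ∧
  Even (Finset.univ.filter
    (fun i : Fin (2*l) => (i:ℕ) < l ∧ l ≤ ((σ i : Fin (2*l)) : ℕ))).card

/-- The action of a (signed) permutation on root vectors `v : Fin l → ℤ`
(in the basis `e_1, …, e_l`). -/
def actD (l : ℕ) (σ : Equiv.Perm (Fin (2*l))) (v : Fin l → ℤ) : Fin l → ℤ :=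
  fun k => ∑ i : Fin l,
    v i * (if ((σ (Fin.castLE (by omega) i) : Fin (2*l)) : ℕ) = (k:ℕ) then 1
      else if ((σ (Fin.castLE (by omega) i) : Fin (2*l)) : ℕ) = 2*l-1-(k:ℕ) then -1 else 0)

/-- The roots of type `D_l`: `±e_i ± e_j`, `i < j`. -/
def isRootD (l : ℕ) (v : Fin l → ℤ) : Prop :=
  ∃ i j : Fin l, (i:ℕ) < (j:ℕ) ∧ ∃ a b : ℤ, (a = 1 ∨ a = -1) ∧ (b = 1 ∨ b = -1) ∧
    v = fun k => if k = i then a else if k = j then b else 0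

/-- Positive roots: the first nonzero coordinate is `+1`. -/
def isPosRootD (l : ℕ) (v : Fin l → ℤ) : Prop :=
  isRootD l v ∧ ∃ i : Fin l, v i = 1 ∧ ∀ j : Fin l, (j:ℕ) < (i:ℕ) → v j = 0

/-- Negative roots: the first nonzero coordinate is `-1`. -/
def isNegRootD (l : ℕ) (v : Fin l → ℤ) : Prop :=
  isRootD l v ∧ ∃ i : Fin l, v i = -1 ∧ ∀ j : Fin l, (j:ℕ) < (i:ℕ) → v j = 0

/-- The simple roots `Δ = {α_1, …, α_l}` of `D_l`:
`α_k = e_k - e_{k+1}` (`k ≤ l-1`) and `α_l = e_{l-1} + e_l`. -/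
def simpleSetD (l : ℕ) : Set (Fin l → ℤ) :=
  {v | (∃ k : ℕ, k + 2 ≤ l ∧
          v = fun j : Fin l => if (j:ℕ) = k then 1 else if (j:ℕ) = k+1 then (-1 : ℤ) else 0) ∨
       v = fun j : Fin l => if (j:ℕ) = l-2 ∨ (j:ℕ) = l-1 then (1 : ℤ) else 0}

/-- The Bessel support `B(SO_{2l})`: Weyl elements sending every simple root to a
negative or simple root. -/
def inBesselD (l : ℕ) (σ : Equiv.Perm (Fin (2*l))) : Prop :=
  inWeylD l σ ∧ ∀ v ∈ simpleSetD l, isNegRootD l (actD l σ v) ∨ actD l σ v ∈ simpleSetD l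

/-- `θ_w = {α ∈ Δ : wα > 0}`. -/
def thetaD (l : ℕ) (σ : Equiv.Perm (Fin (2*l))) : Set (Fin l → ℤ) :=
  {v | v ∈ simpleSetD l ∧ isPosRootD l (actD l σ v)}

/-- The length of a Weyl element: the number of positive roots made negative. -/
def lenD (l : ℕ) (σ : Equiv.Perm (Fin (2*l))) : ℕ :=
  Set.ncard {v | isPosRootD l v ∧ isNegRootD l (actD l σ v)}

/-- Reflections of `W(D_l)` in this realization. -/
def isReflD (l : ℕ) (τ : Equiv.Perm (Fin (2*l))) : Prop :=
  ∃ a b : Fin (2*l), a ≠ b ∧ a ≠ revF l b ∧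
    τ = Equiv.swap a b * Equiv.swap (revF l a) (revF l b)

/-- The (combinatorial) Bruhat order: `x ≤ y` iff there is a chain from `x` to `y`
multiplying by reflections and increasing length at each step. -/
def bruhatLE (l : ℕ) : Equiv.Perm (Fin (2*l)) → Equiv.Perm (Fin (2*l)) → Prop :=
  Relation.ReflTransGen
    (fun x y => (∃ τ, isReflD l τ ∧ y = τ * x) ∧ lenD l x < lenD l y)

namespace WeylD

variable {l : ℕ}

/-- The weight `e_a` for `a < l`, extended by `e_{2l-1-a} = -e_a`. -/
def weight (l a : ℕ) : Fin l → ℤ :=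
  fun k => if a = (k:ℕ) then 1 else if a = 2*l-1-(k:ℕ) then -1 else 0

@[simp] lemma revF_val (a : Fin (2*l)) : ((revF l a : Fin (2*l)) : ℕ) = 2*l-1-(a:ℕ) := rfl

@[simp] lemma revF_revF (a : Fin (2*l)) : revF l (revF l a) = a := by
  ext; simp; omega

lemma weight_revF (a : Fin (2*l)) : weight l (revF l a) = -weight l a := by
  ext k
  have := a.isLt
  have := k.isLt
  simp only [weight, revF_val, Pi.neg_apply]
  split_ifs <;> omega

lemma actD_eq_sum (σ : Equiv.Perm (Fin (2*l))) (v : Fin l → ℤ) :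
    actD l σ v = ∑ i : Fin l, v i • weight l (σ (Fin.castLE (by omega) i)) := by
  ext k
  simp [actD, weight]

/-- The action of `σ` as an additive map. -/
def actHom (σ : Equiv.Perm (Fin (2*l))) : (Fin l → ℤ) →+ (Fin l → ℤ) where
  toFun := actD l σ
  map_zero' := by simp [actD_eq_sum]
  map_add' v w := by simp [actD_eq_sum, add_smul, Finset.sum_add_distrib]

lemma actD_add (σ : Equiv.Perm (Fin (2*l))) (v w : Fin l → ℤ) :
    actD l σ (v + w) = actD l σ v + actD l σ w := map_add (actHom σ) v w

lemma actD_neg (σ : Equiv.Perm (Fin (2*l))) (v : Fin l → ℤ) :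
    actD l σ (-v) = -actD l σ v := map_neg (actHom σ) v

lemma actD_sub (σ : Equiv.Perm (Fin (2*l))) (v w : Fin l → ℤ) :
    actD l σ (v - w) = actD l σ v - actD l σ w := map_sub (actHom σ) v w

lemma actD_zero (σ : Equiv.Perm (Fin (2*l))) : actD l σ 0 = 0 := map_zero (actHom σ)

lemma actD_zsmul (σ : Equiv.Perm (Fin (2*l))) (c : ℤ) (v : Fin l → ℤ) :
    actD l σ (c • v) = c • actD l σ v := map_zsmul (actHom σ) c v

lemma actD_sum {ι : Type*} (s : Finset ι) (σ : Equiv.Perm (Fin (2*l))) (f : ι → Fin l → ℤ) :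
    actD l σ (∑ i ∈ s, f i) = ∑ i ∈ s, actD l σ (f i) := map_sum (actHom σ) f s

/-- Signed permutations: those commuting with `revF`. -/
def IsSigned (σ : Equiv.Perm (Fin (2*l))) : Prop := ∀ i, σ (revF l i) = revF l (σ i)

lemma IsSigned.mul {σ τ : Equiv.Perm (Fin (2*l))} (hσ : IsSigned σ) (hτ : IsSigned τ) :
    IsSigned (σ * τ) := fun i => by rw [Equiv.Perm.mul_apply, hτ, hσ, Equiv.Perm.mul_apply]

lemma IsSigned.inv {σ : Equiv.Perm (Fin (2*l))} (hσ : IsSigned σ) : IsSigned σ⁻¹ := fun i => by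
  rw [Equiv.Perm.inv_eq_iff_eq, hσ]; simp

lemma weight_castLE (i : Fin l) : weight l (Fin.castLE (by omega : l ≤ 2*l) i) = Pi.single i 1 := by
  ext k
  have := i.isLt
  have := k.isLt
  simp only [weight, Fin.val_castLE, Pi.single_apply, Fin.ext_iff]
  split_ifs <;> omega

lemma eq_sum_weight (v : Fin l → ℤ) :
    v = ∑ i : Fin l, v i • weight l (Fin.castLE (by omega : l ≤ 2*l) i) := by
  simp only [weight_castLE]
  ext k
  simp [Pi.single_apply]

lemma actD_weight {σ : Equiv.Perm (Fin (2*l))} (hσ : IsSigned σ) (a : Fin (2*l)) :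
    actD l σ (weight l a) = weight l (σ a) := by
  have key : ∀ i : Fin l, actD l σ (weight l (Fin.castLE (by omega : l ≤ 2*l) i)) =
      weight l (σ (Fin.castLE (by omega) i)) := fun i => by
    rw [weight_castLE, actD_eq_sum, Finset.sum_eq_single i]
    · simp
    · intro j _ hj; simp [hj]
    · simp
  by_cases ha : (a:ℕ) < l
  · exact key ⟨a, ha⟩
  · have := a.isLt
    have h := key ⟨2*l-1-a, by omega⟩
    have e : Fin.castLE (by omega : l ≤ 2*l) ⟨2*l-1-(a:ℕ), by omega⟩ = revF l a := rfl
    rw [e, weight_revF, hσ, weight_revF, actD_neg] at h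
    exact neg_injective h

lemma actD_mul {σ : Equiv.Perm (Fin (2*l))} (hσ : IsSigned σ) (τ : Equiv.Perm (Fin (2*l)))
    (v : Fin l → ℤ) : actD l (σ * τ) v = actD l σ (actD l τ v) := by
  rw [actD_eq_sum τ, actD_sum, actD_eq_sum]
  simp only [actD_zsmul, actD_weight hσ, Equiv.Perm.mul_apply]

lemma actD_one (v : Fin l → ℤ) : actD l 1 v = v := by
  rw [actD_eq_sum]; exact (eq_sum_weight v).symm

lemma actD_inv_actD {σ : Equiv.Perm (Fin (2*l))} (hσ : IsSigned σ) (v : Fin l → ℤ) :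
    actD l σ⁻¹ (actD l σ v) = v := by
  rw [← actD_mul hσ.inv, inv_mul_cancel, actD_one]

lemma actD_actD_inv {σ : Equiv.Perm (Fin (2*l))} (hσ : IsSigned σ) (v : Fin l → ℤ) :
    actD l σ (actD l σ⁻¹ v) = v := by
  rw [← actD_mul hσ, mul_inv_cancel, actD_one]

/-! ### Roots as differences of weights -/

lemma isNegRootD_iff (v : Fin l → ℤ) : isNegRootD l v ↔ isPosRootD l (-v) := by
  have aux : ∀ v : Fin l → ℤ, isRootD l v → isRootD l (-v) := by
    rintro v ⟨i, j, hij, a, b, ha, hb, rfl⟩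
    refine ⟨i, j, hij, -a, -b, by omega, by omega, ?_⟩
    ext k
    simp only [Pi.neg_apply]
    split_ifs <;> simp
  constructor
  · rintro ⟨h, i, hi, hj⟩
    exact ⟨aux v h, i, by simp [hi], fun j h => by simp [hj j h]⟩
  · rintro ⟨h, i, hi, hj⟩
    refine ⟨by simpa using aux _ h, i, ?_, fun j h => by simpa using hj j h⟩
    simp only [Pi.neg_apply] at hi
    omega

lemma _root_.isPosRootD.exists_weight {v : Fin l → ℤ} (hv : isPosRootD l v) :
    ∃ a b : Fin (2*l), (a:ℕ) < l ∧ a < b ∧ b < revF l a ∧ v = weight l a - weight l b := by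
  obtain ⟨⟨i, j, hij, a, b, ha, hb, rfl⟩, k, hk, hlt⟩ := hv
  have hi := i.isLt
  have hj := j.isLt
  have hki : k = i := by
    rcases lt_trichotomy (k:ℕ) i with h | h | h
    · simp only [Fin.ext_iff] at hk
      split_ifs at hk <;> omega
    · exact Fin.ext h
    · have := hlt i h
      simp only [if_true] at this
      omega
  subst hki
  simp only [if_true] at hk
  subst hk
  rcases hb with rfl | rfl
  · refine ⟨⟨k, by omega⟩, ⟨2*l-1-j, by omega⟩, hi, ?_, ?_, ?_⟩
    · simp only [Fin.lt_def]; omega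
    · simp only [Fin.lt_def, revF_val]; omega
    · ext m
      have := m.isLt
      simp only [weight, Pi.sub_apply, Fin.ext_iff]
      split_ifs <;> omega
  · refine ⟨⟨k, by omega⟩, ⟨j, by omega⟩, hi, ?_, ?_, ?_⟩
    · simp only [Fin.lt_def]; omega
    · simp only [Fin.lt_def, revF_val]; omega
    · ext m
      have := m.isLt
      simp only [weight, Pi.sub_apply, Fin.ext_iff]
      split_ifs <;> omega

lemma isPosRootD_weight_sub {a b : Fin (2*l)} (hab : a < b) (hr : a ≠ revF l b) :
    isPosRootD l (weight l a - weight l b) := by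
  have ha := a.isLt
  have hb := b.isLt
  have hr' : (a:ℕ) ≠ 2*l-1-b := fun h => hr (Fin.ext h)
  rw [Fin.lt_def] at hab
  have main : ∀ (i j : ℕ) (hi : i < l) (hj : j < l) (c : ℤ), i < j → (c = 1 ∨ c = -1) →
      (∀ m : Fin l, (weight l a - weight l b) m =
        if (m:ℕ) = i then 1 else if (m:ℕ) = j then c else 0) →
      isPosRootD l (weight l a - weight l b) := by
    intro i j hi hj c hij hc h
    refine ⟨⟨⟨i, hi⟩, ⟨j, hj⟩, hij, 1, c, Or.inl rfl, hc, ?_⟩, ⟨i, hi⟩, by simp [h], ?_⟩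
    · ext m; simp only [h, Fin.ext_iff]
    · intro m hm
      simp only at hm
      rw [h, if_neg (by omega), if_neg (by omega)]
  have fin : ∀ (i j : ℕ) (c : ℤ), (a:ℕ) < l ∧ b < l ∧ i = a ∧ j = b ∧ c = -1 ∨
      (a:ℕ) < l ∧ l ≤ b ∧ i = a ∧ j = 2*l-1-b ∧ c = 1 ∨
      (a:ℕ) < l ∧ l ≤ b ∧ j = a ∧ i = 2*l-1-b ∧ c = 1 ∨
      l ≤ (a:ℕ) ∧ i = 2*l-1-b ∧ j = 2*l-1-a ∧ c = -1 →
      i < j → ∀ m : Fin l, (weight l a - weight l b) m =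
        if (m:ℕ) = i then 1 else if (m:ℕ) = j then c else 0 := by
    intro i j c h hij m
    have := m.isLt
    simp only [weight, Pi.sub_apply]
    split_ifs <;> omega
  by_cases hal : (a:ℕ) < l
  · by_cases hbl : (b:ℕ) < l
    · exact main a b hal hbl (-1) hab (by simp) (fin _ _ _ (by omega) hab)
    · rcases lt_or_gt_of_ne hr' with h | h
      · exact main a (2*l-1-b) hal (by omega) 1 h (by simp) (fin _ _ _ (by omega) h)
      · exact main (2*l-1-b) a (by omega) hal 1 h (by simp) (fin _ _ _ (by omega) h)
  · have h : 2*l-1-(b:ℕ) < 2*l-1-a := by omega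
    exact main _ _ (by omega) (by omega) (-1) h (by simp) (fin _ _ _ (by omega) h)

lemma _root_.isPosRootD.not_neg {v : Fin l → ℤ} (hv : isPosRootD l v) : ¬ isPosRootD l (-v) := by
  rintro ⟨-, j, hj, hj'⟩
  obtain ⟨-, i, hi, hi'⟩ := hv
  simp only [Pi.neg_apply] at hj hj'
  rcases lt_trichotomy (i:ℕ) j with h | h | h
  · have := hj' i h; omega
  · rw [Fin.ext h] at hi; omega
  · have := hi' j h; omega

lemma isPosRootD_weight_sub_iff {a b : Fin (2*l)} (hab : a ≠ b) (hr : a ≠ revF l b) :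
    isPosRootD l (weight l a - weight l b) ↔ a < b := by
  refine ⟨fun h => ?_, fun h => isPosRootD_weight_sub h hr⟩
  by_contra hlt
  have hr' : b ≠ revF l a := by rintro rfl; simp at hr
  exact h.not_neg (by
    rw [neg_sub]; exact isPosRootD_weight_sub (lt_of_le_of_ne (not_lt.1 hlt) hab.symm) hr')

lemma _root_.isPosRootD.actD {v : Fin l → ℤ} (hv : isPosRootD l v) {σ : Equiv.Perm (Fin (2*l))}
    (hσ : IsSigned σ) : isPosRootD l (actD l σ v) ∨ isPosRootD l (-actD l σ v) := by
  obtain ⟨a, b, ha, hab, hba, rfl⟩ := hv.exists_weight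
  have hr : b ≠ revF l a := hba.ne
  rw [actD_sub, actD_weight hσ, actD_weight hσ, neg_sub]
  have h1 : σ a ≠ σ b := fun h => hab.ne (σ.injective h)
  have h2 : σ b ≠ revF l (σ a) := fun h => hr (σ.injective (by rw [h, hσ]))
  have h3 : σ a ≠ revF l (σ b) := fun h => h2 (by rw [h, revF_revF])
  rcases lt_or_gt_of_ne h1 with h | h
  · exact Or.inl (isPosRootD_weight_sub h h3)
  · exact Or.inr (isPosRootD_weight_sub h h2)

lemma finite_posRoots : {v | isPosRootD l v}.Finite := by
  refine (Set.finite_range (fun p : Fin (2*l) × Fin (2*l) => weight l p.1 - weight l p.2)).subset ?_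
  intro v hv
  obtain ⟨a, b, -, -, -, rfl⟩ := isPosRootD.exists_weight hv
  exact ⟨(a, b), rfl⟩

/-! ### Simple roots -/

lemma mem_simpleSetD_of_succ {a b : Fin (2*l)} (hb : (b:ℕ) = a + 1) (hbl : (b:ℕ) < l) :
    weight l a - weight l b ∈ simpleSetD l := by
  refine Or.inl ⟨a, by omega, ?_⟩
  ext m
  have := m.isLt
  simp only [weight, Pi.sub_apply]
  split_ifs <;> omega

lemma weight_sub_revF (a b : Fin (2*l)) :
    weight l a - weight l b = weight l (revF l b) - weight l (revF l a) := by
  rw [weight_revF, weight_revF]; abel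

lemma mem_simpleSetD_of_last {a b : Fin (2*l)} (ha : (a:ℕ) + 2 = l) (hb : (b:ℕ) = l) :
    weight l a - weight l b ∈ simpleSetD l := by
  refine Or.inr ?_
  ext m
  have := m.isLt
  simp only [weight, Pi.sub_apply]
  split_ifs <;> omega

lemma simple_or_exists_between {a b : Fin (2*l)} (hab : a < b) (hr : a ≠ revF l b) :
    weight l a - weight l b ∈ simpleSetD l ∨
      ∃ c, a < c ∧ c < b ∧ a ≠ revF l c ∧ c ≠ revF l b := by
  have ha := a.isLt
  have hb := b.isLt
  have hr' : (a:ℕ) ≠ 2*l-1-b := fun h => hr (Fin.ext h)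
  rw [Fin.lt_def] at hab
  by_cases h1 : (b:ℕ) = a + 1
  · left
    by_cases hbl : (b:ℕ) < l
    · exact mem_simpleSetD_of_succ h1 hbl
    · rw [weight_sub_revF]
      exact mem_simpleSetD_of_succ (by simp only [revF_val]; omega) (by simp only [revF_val]; omega)
  by_cases h2 : (a:ℕ) + 2 = l ∧ (b:ℕ) = l
  · exact Or.inl (mem_simpleSetD_of_last h2.1 h2.2)
  by_cases h3 : (a:ℕ) + 1 = l ∧ (b:ℕ) = l + 1
  · left
    rw [weight_sub_revF]
    exact mem_simpleSetD_of_last (by simp only [revF_val]; omega) (by simp only [revF_val]; omega)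
  right
  by_cases hc : (a:ℕ) + 1 ≠ 2*l-1-a ∧ (a:ℕ) + 1 ≠ 2*l-1-b
  · refine ⟨⟨a+1, by omega⟩, ?_⟩
    simp only [Fin.lt_def, ne_eq, Fin.ext_iff, revF_val]
    omega
  · refine ⟨⟨b-1, by omega⟩, ?_⟩
    simp only [Fin.lt_def, ne_eq, Fin.ext_iff, revF_val]
    omega

lemma _root_.isPosRootD.simple_or_add {v : Fin l → ℤ} (hv : isPosRootD l v) :
    v ∈ simpleSetD l ∨ ∃ μ ν, isPosRootD l μ ∧ isPosRootD l ν ∧ v = μ + ν := by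
  obtain ⟨a, b, ha, hab, hba, rfl⟩ := hv.exists_weight
  have hr : a ≠ revF l b := by rintro h; rw [h] at hba; simp at hba
  refine (simple_or_exists_between hab hr).imp_right ?_
  rintro ⟨c, hac, hcb, hc, hc'⟩
  exact ⟨_, _, isPosRootD_weight_sub hac hc, isPosRootD_weight_sub hcb hc', by abel⟩

lemma _root_.isPosRootD.mem_closure {v : Fin l → ℤ} (hv : isPosRootD l v) :
    v ∈ AddSubmonoid.closure (simpleSetD l) := by
  have key : ∀ (n : ℕ) (a b : Fin (2*l)), (b:ℕ) - a ≤ n → a < b → a ≠ revF l b →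
      weight l a - weight l b ∈ AddSubmonoid.closure (simpleSetD l) := by
    intro n
    induction n with
    | zero => intro a b h hab; rw [Fin.lt_def] at hab; omega
    | succ n ih =>
      intro a b h hab hr
      rcases simple_or_exists_between hab hr with hs | ⟨c, hac, hcb, hc, hc'⟩
      · exact AddSubmonoid.subset_closure hs
      · rw [show weight l a - weight l b =
          (weight l a - weight l c) + (weight l c - weight l b) by abel]
        have h1 := Fin.lt_def.1 hac
        have h2 := Fin.lt_def.1 hcb
        exact add_mem (ih a c (by omega) hac hc) (ih c b (by omega) hcb hc')
  obtain ⟨a, b, ha, hab, hba, rfl⟩ := hv.exists_weight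
  exact key _ a b le_rfl hab (by rintro h; rw [h] at hba; simp at hba)

lemma isPosRootD_of_mem_simpleSetD (hl : 2 ≤ l) {v : Fin l → ℤ} (hv : v ∈ simpleSetD l) :
    isPosRootD l v := by
  rcases hv with ⟨k, hk, rfl⟩ | rfl
  · convert isPosRootD_weight_sub (l := l) (a := ⟨k, by omega⟩) (b := ⟨k+1, by omega⟩)
      (by simp [Fin.lt_def]) (by simp only [ne_eq, Fin.ext_iff, revF_val]; omega) using 1
    ext m
    have := m.isLt
    simp only [weight, Pi.sub_apply]
    split_ifs <;> omega
  · convert isPosRootD_weight_sub (l := l) (a := ⟨l-2, by omega⟩) (b := ⟨l, by omega⟩)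
      (by simp only [Fin.lt_def]; omega) (by simp only [ne_eq, Fin.ext_iff, revF_val]; omega)
      using 1
    ext m
    have := m.isLt
    simp only [weight, Pi.sub_apply]
    split_ifs <;> omega

/-- The functional `v ↦ ∑ c_i v_i`. -/
def dot (l : ℕ) (c : ℕ → ℤ) : (Fin l → ℤ) →+ ℤ where
  toFun v := ∑ i : Fin l, c i * v i
  map_zero' := by simp
  map_add' v w := by simp [mul_add, Finset.sum_add_distrib]

lemma dot_simple (c : ℕ → ℤ) {k : ℕ} (hk : k + 2 ≤ l) :
    dot l c (fun j : Fin l => if (j:ℕ) = k then 1 else if (j:ℕ) = k+1 then (-1 : ℤ) else 0) =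
      c k - c (k+1) := by
  have : (fun j : Fin l => if (j:ℕ) = k then 1 else if (j:ℕ) = k+1 then (-1 : ℤ) else 0) =
      Pi.single ⟨k, by omega⟩ 1 - Pi.single ⟨k+1, by omega⟩ 1 := by
    ext j
    simp only [Pi.sub_apply, Pi.single_apply, Fin.ext_iff]
    split_ifs <;> omega
  rw [this, map_sub]
  simp [dot, Pi.single_apply]

lemma dot_last (hl : 2 ≤ l) (c : ℕ → ℤ) :
    dot l c (fun j : Fin l => if (j:ℕ) = l-2 ∨ (j:ℕ) = l-1 then (1 : ℤ) else 0) =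
      c (l-2) + c (l-1) := by
  have : (fun j : Fin l => if (j:ℕ) = l-2 ∨ (j:ℕ) = l-1 then (1 : ℤ) else 0) =
      Pi.single ⟨l-2, by omega⟩ 1 + Pi.single ⟨l-1, by omega⟩ 1 := by
    ext j
    simp only [Pi.add_apply, Pi.single_apply, Fin.ext_iff]
    split_ifs <;> omega
  rw [this, map_add]
  simp [dot, Pi.single_apply]

lemma exists_height (hl : 2 ≤ l) : ∃ h : (Fin l → ℤ) →+ ℤ, ∀ α ∈ simpleSetD l, h α = 1 := by
  refine ⟨dot l (fun i => (l:ℤ) - 1 - i), ?_⟩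
  rintro α (⟨k, hk, rfl⟩ | rfl)
  · rw [dot_simple _ hk]; push_cast; ring
  · rw [dot_last hl]; push_cast [Nat.cast_sub (by omega : 1 ≤ l), Nat.cast_sub hl]; ring

/-- Up to positive scalars, the fundamental coweights. -/
lemma exists_dual (hl : 2 ≤ l) : ∃ d : (Fin l → ℤ) → (Fin l → ℤ) →+ ℤ,
    ∀ α ∈ simpleSetD l, 0 < d α α ∧ ∀ β ∈ simpleSetD l, β ≠ α → d α β = 0 := by
  suffices h : ∀ α : Fin l → ℤ, ∃ d : (Fin l → ℤ) →+ ℤ, α ∈ simpleSetD l →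
      0 < d α ∧ ∀ β ∈ simpleSetD l, β ≠ α → d β = 0 by
    choose d hd using h
    exact ⟨d, hd⟩
  intro α
  by_cases hα : α ∈ simpleSetD l
  swap
  · exact ⟨0, fun h => absurd h hα⟩
  rcases hα with ⟨k, hk, rfl⟩ | rfl
  · refine ⟨dot l (fun i => if i ≤ k then 1 else if k + 2 = l then -1 else 0), fun _ => ⟨?_, ?_⟩⟩
    · rw [dot_simple _ hk]
      split_ifs <;> omega
    · rintro β (⟨m, hm, rfl⟩ | rfl) hne
      · have : m ≠ k := by rintro rfl; exact hne rfl
        rw [dot_simple _ hm]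
        split_ifs <;> omega
      · rw [dot_last hl]
        split_ifs <;> omega
  · refine ⟨dot l (fun _ => 1), fun _ => ⟨?_, ?_⟩⟩
    · rw [dot_last hl]; norm_num
    · rintro β (⟨m, hm, rfl⟩ | rfl) hne
      · rw [dot_simple _ hm]; norm_num
      · exact absurd rfl hne


/-! ### Reflections -/

/-- The reflection in the root `weight l a - weight l b`. -/
def refl (a b : Fin (2*l)) : Equiv.Perm (Fin (2*l)) :=
  Equiv.swap a b * Equiv.swap (revF l a) (revF l b)

lemma refl_apply {a b : Fin (2*l)} (hr : a ≠ revF l b) (i : Fin (2*l)) :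
    refl a b i = if i = a then b else if i = b then a else if i = revF l a then revF l b
      else if i = revF l b then revF l a else i := by
  have ha := a.isLt
  have hb := b.isLt
  have hi := i.isLt
  simp only [refl, Equiv.Perm.mul_apply, Equiv.swap_apply_def, ne_eq, Fin.ext_iff,
    revF_val] at hr ⊢
  split_ifs <;> (try simp only [revF_val] at *) <;> omega

lemma refl_comm (a b : Fin (2*l)) : refl a b = refl b a := by
  simp [refl, Equiv.swap_comm]

lemma refl_mul_self {a b : Fin (2*l)} (hab : a ≠ b) (hr : a ≠ revF l b) :
    refl a b * refl a b = 1 := by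
  have hc : Commute (Equiv.swap a b) (Equiv.swap (revF l a) (revF l b)) := by
    refine (Equiv.Perm.disjoint_swap_swap ?_).commute
    have ha := a.isLt
    have hb := b.isLt
    simp only [ne_eq, Fin.ext_iff, revF_val] at hab hr
    simp only [List.nodup_cons, List.mem_cons, List.not_mem_nil, List.nodup_nil, Fin.ext_iff,
      revF_val, or_false, not_or, not_false_eq_true, and_true]
    omega
  rw [refl, hc.symm.mul_mul_mul_comm, Equiv.swap_mul_self, Equiv.swap_mul_self, one_mul]

lemma isSigned_refl {a b : Fin (2*l)} (hr : a ≠ revF l b) :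
    IsSigned (refl a b) := by
  intro i
  have ha := a.isLt
  have hb := b.isLt
  have hi := i.isLt
  simp only [refl_apply hr, Fin.ext_iff, revF_val]
  simp only [ne_eq, Fin.ext_iff, revF_val] at hr ⊢
  split_ifs <;> (try simp only [revF_val] at *) <;> omega

lemma exists_actD_refl {a b : Fin (2*l)} (hr : a ≠ revF l b) (v : Fin l → ℤ) :
    ∃ m : ℤ, actD l (refl a b) v = v - m • (weight l a - weight l b) := by
  have key : ∀ c : Fin (2*l), ∃ m : ℤ,
      weight l (refl a b c) = weight l c - m • (weight l a - weight l b) := by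
    intro c
    rw [refl_apply hr]
    split_ifs with h1 h2 h3 h4
    · exact ⟨1, by rw [h1]; simp⟩
    · exact ⟨-1, by rw [h2]; simp⟩
    · exact ⟨-1, by rw [h3, weight_revF, weight_revF]; module⟩
    · exact ⟨1, by rw [h4, weight_revF, weight_revF]; module⟩
    · exact ⟨0, by simp⟩
  choose m hm using key
  refine ⟨∑ i : Fin l, v i * m (Fin.castLE (by omega) i), ?_⟩
  rw [actD_eq_sum]
  simp only [hm, smul_sub, Finset.sum_sub_distrib, Finset.sum_smul, mul_smul]
  rw [← eq_sum_weight]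

lemma actD_refl_self {a b : Fin (2*l)} (hab : a ≠ b) (hr : a ≠ revF l b) :
    actD l (refl a b) (weight l a - weight l b) = -(weight l a - weight l b) := by
  rw [actD_sub, actD_weight (isSigned_refl hr), actD_weight (isSigned_refl hr),
    refl_apply hr, refl_apply hr]
  simp [hab.symm]

lemma refl_mul {x : Equiv.Perm (Fin (2*l))} (hx : IsSigned x) (a b : Fin (2*l)) :
    refl (x a) (x b) * x = x * refl a b := by
  rw [refl, refl, ← hx, ← hx, mul_assoc, ← Equiv.mul_swap_eq_swap_mul, ← mul_assoc,
    ← Equiv.mul_swap_eq_swap_mul, mul_assoc]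

/-! ### Parity -/

/-- `-1` to the number of sign changes. -/
def parity (x : Equiv.Perm (Fin (2*l))) : ℤ :=
  ∏ i : Fin (2*l), if (i:ℕ) < l ∧ l ≤ (x i : ℕ) then -1 else 1

lemma inWeylD_iff (x : Equiv.Perm (Fin (2*l))) : inWeylD l x ↔ IsSigned x ∧ parity x = 1 := by
  rw [inWeylD, parity, Finset.prod_ite]
  simp only [Finset.prod_const, one_pow, mul_one]
  rw [neg_one_pow_eq_one_iff_even (by norm_num)]
  rfl

lemma parity_mul_refl {x : Equiv.Perm (Fin (2*l))} (hx : IsSigned x) {a b : Fin (2*l)}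
    (ha : (a:ℕ) < l) (hab : a < b) (hba : b < revF l a) : parity (x * refl a b) = parity x := by
  have hr : a ≠ revF l b := by rintro h; rw [h] at hba; simp at hba
  have hblt := b.isLt
  have hxr : ∀ c, (x (revF l c) : ℕ) = 2*l-1-(x c : ℕ) := fun c => by rw [hx]; rfl
  by_cases hbl : (b:ℕ) < l
  · unfold parity
    rw [← Equiv.prod_comp (refl a b) (fun i => if (i:ℕ) < l ∧ l ≤ (x i : ℕ) then (-1:ℤ) else 1)]
    refine Finset.prod_congr rfl fun i _ => ?_
    have : ((refl a b i : Fin (2*l)) : ℕ) < l ↔ (i:ℕ) < l := by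
      rw [refl_apply hr]
      split_ifs <;> simp only [Fin.ext_iff, revF_val] at * <;> omega
    exact if_congr (and_congr_left' this.symm) rfl rfl
  · have hbv : ((revF l b : Fin (2*l)) : ℕ) = 2*l-1-b := rfl
    have hav : ((revF l a : Fin (2*l)) : ℕ) = 2*l-1-a := rfl
    set c := revF l b with hc
    have hbc : b = revF l c := by rw [hc, revF_revF]
    have hac : a ≠ revF l c := by rw [← hbc]; exact hab.ne
    have hcl : (c:ℕ) < l := by omega
    have hp : parity (x * refl a b) = ∏ i : Fin (2*l),
        (if ((refl a c i : Fin (2*l)) : ℕ) < l ∧ l ≤ (x (refl a c i) : ℕ) then (-1:ℤ) else 1) *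
          ((if i = a then -1 else 1) * (if i = c then -1 else 1)) := by
      refine Finset.prod_congr rfl fun i _ => ?_
      have hilt := i.isLt
      have hxa := (x a).isLt
      have hxc := (x c).isLt
      have hca : c ≠ a := hr.symm
      have hbrc := hxr c
      rw [← hbc] at hbrc
      rw [Equiv.Perm.mul_apply, refl_apply hr, refl_apply hac]
      by_cases hia : i = a
      · subst hia
        simp only [if_true, if_neg hr]
        split_ifs <;> omega
      by_cases hic : i = c
      · subst hic
        have h1 : c ≠ b := by intro h; rw [h] at hcl; omega
        have h2 : c ≠ revF l a := by intro h; rw [h] at hcl; omega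
        have := hxr a
        simp only [if_true, if_neg hca, if_neg h1, if_neg h2, ← hc]
        split_ifs <;> omega
      have hne : ∀ j : Fin (2*l), i ≠ j → (i:ℕ) ≠ j := fun j h h' => h (Fin.ext h')
      have := hne a hia
      have := hne c hic
      by_cases hil : (i:ℕ) < l
      · have h1 : i ≠ b := by intro h; rw [h] at hil; omega
        have h2 : i ≠ revF l a := by intro h; rw [h] at hil; omega
        have h3 : i ≠ revF l c := by rw [← hbc]; exact h1
        simp only [if_neg hia, if_neg hic, if_neg h1, if_neg h2, if_neg h3, ← hc, mul_one]
      · have hrc : ((revF l c : Fin (2*l)) : ℕ) = 2*l-1-c := rfl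
        simp only [if_neg hia, if_neg hic, mul_one]
        rw [if_neg (by tauto), if_neg]
        rintro ⟨h, -⟩
        split_ifs at h <;> omega
    rw [hp, Finset.prod_mul_distrib, Finset.prod_mul_distrib,
      Equiv.prod_comp (refl a c) (fun i => if (i:ℕ) < l ∧ l ≤ (x i : ℕ) then (-1:ℤ) else 1)]
    simp [parity]

/-- Every positive root has a reflection `s`, and right multiplication by `s` preserves the Weyl
group and is left multiplication by a reflection. -/
lemma exists_refl {γ : Fin l → ℤ} (hγ : isPosRootD l γ) : ∃ s : Equiv.Perm (Fin (2*l)),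
    s * s = 1 ∧ IsSigned s ∧ actD l s γ = -γ ∧ (∀ v, ∃ m : ℤ, actD l s v = v - m • γ) ∧
    (∀ x, inWeylD l x → inWeylD l (x * s)) ∧
    ∀ x, IsSigned x → ∃ t, isReflD l t ∧ t * x = x * s := by
  obtain ⟨a, b, ha, hab, hba, rfl⟩ := hγ.exists_weight
  have hr : a ≠ revF l b := by rintro h; rw [h] at hba; simp at hba
  refine ⟨refl a b, refl_mul_self hab.ne hr, isSigned_refl hr, actD_refl_self hab.ne hr,
    exists_actD_refl hr, fun x hx => ?_, fun x hx => ?_⟩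
  · rw [inWeylD_iff] at hx ⊢
    exact ⟨hx.1.mul (isSigned_refl hr), by rw [parity_mul_refl hx.1 ha hab hba, hx.2]⟩
  · exact ⟨refl (x a) (x b), ⟨x a, x b, x.injective.ne hab.ne, fun h => hr (x.injective
      (by rw [h, hx])), rfl⟩, refl_mul hx a b⟩

/-- Left multiplication by a reflection is right multiplication by the reflection in a
positive root. -/
lemma exists_refl_of_isReflD {t x : Equiv.Perm (Fin (2*l))} (ht : isReflD l t)
    (hx : IsSigned x) : ∃ γ s, isPosRootD l γ ∧ t * x = x * s ∧ s * s = 1 ∧ IsSigned s ∧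
      actD l s γ = -γ ∧ ∀ v, ∃ m : ℤ, actD l s v = v - m • γ := by
  have key : ∀ a b : Fin (2*l), a < b → a ≠ revF l b → ∃ γ s, isPosRootD l γ ∧
      refl (x a) (x b) * x = x * s ∧ s * s = 1 ∧ IsSigned s ∧
      actD l s γ = -γ ∧ ∀ v, ∃ m : ℤ, actD l s v = v - m • γ := fun a b hab hr =>
    ⟨_, refl a b, isPosRootD_weight_sub hab hr, refl_mul hx a b, refl_mul_self hab.ne hr,
      isSigned_refl hr, actD_refl_self hab.ne hr, exists_actD_refl hr⟩
  obtain ⟨a', b', hne, hr', rfl⟩ := ht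
  obtain ⟨a, rfl⟩ := x.surjective a'
  obtain ⟨b, rfl⟩ := x.surjective b'
  have hr : a ≠ revF l b := fun h => hr' (by rw [h, hx])
  rcases lt_or_gt_of_ne (fun h => hne (congrArg x h)) with h | h
  · exact key a b h hr
  · have := key b a h (fun h => hr (by rw [h, revF_revF]))
    rwa [refl_comm] at this

/-! ### Rigidity -/

lemma eq_of_pos_iff {x y : Equiv.Perm (Fin (2*l))} (hx : inWeylD l x) (hy : inWeylD l y)
    (h : ∀ γ, isPosRootD l γ → (isPosRootD l (actD l x γ) ↔ isPosRootD l (actD l y γ))) :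
    x = y := by
  obtain ⟨hxs, hxe⟩ := hx
  obtain ⟨hys, hye⟩ := hy
  have hlt : ∀ a b : Fin (2*l), a < b → a ≠ revF l b → (x a < x b ↔ y a < y b) := by
    intro a b hab hr
    have hpair : ∀ z : Equiv.Perm (Fin (2*l)), (∀ i, z (revF l i) = revF l (z i)) →
        (isPosRootD l (actD l z (weight l a - weight l b)) ↔ z a < z b) := fun z hz => by
      rw [actD_sub, actD_weight hz, actD_weight hz, isPosRootD_weight_sub_iff
        (z.injective.ne hab.ne) (fun h => hr (z.injective (by rw [h, hz])))]
    rw [← hpair x hxs, ← hpair y hys]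
    exact h _ (isPosRootD_weight_sub hab hr)
  have hlt' : ∀ c a : Fin (2*l), c ≠ revF l a → (x c < x a ↔ y c < y a) := by
    intro c a hr
    rcases lt_trichotomy c a with h | h | h
    · exact hlt c a h hr
    · simp [h]
    · have := hlt a c h (fun h => hr (by rw [h, revF_revF]))
      rw [lt_iff_le_and_ne, lt_iff_le_and_ne, ← not_lt, ← not_lt, this,
        x.injective.ne_iff, y.injective.ne_iff]
  have hcard : ∀ (z : Equiv.Perm (Fin (2*l))) (a : Fin (2*l)),
      (z a : ℕ) = (Finset.univ.filter (fun c => z c < z a)).card := by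
    intro z a
    rw [← Fin.card_Iio (z a)]
    refine (Finset.card_bij (fun c _ => z c) (by simp) (fun _ _ _ _ h => z.injective h) ?_).symm
    intro b hb
    exact ⟨z.symm b, by simpa using hb, by simp⟩
  have hrev : ∀ z : Equiv.Perm (Fin (2*l)), (∀ i, z (revF l i) = revF l (z i)) →
      ∀ a, z (revF l a) < z a ↔ l ≤ (z a : ℕ) := by
    intro z hz a
    rw [hz, Fin.lt_def, revF_val]
    omega
  have hsame : ∀ a, (l ≤ (x a : ℕ) ↔ l ≤ (y a : ℕ)) → x a = y a := by
    intro a ha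
    ext
    rw [hcard x a, hcard y a]
    congr 1
    ext c
    simp only [Finset.mem_filter_univ]
    by_cases hc : c = revF l a
    · rw [hc, hrev x hxs, hrev y hys, ha]
    · exact hlt' c a hc
  have hdiff : ∀ (x y : Equiv.Perm (Fin (2*l))), (∀ i, x (revF l i) = revF l (x i)) →
      (∀ i, y (revF l i) = revF l (y i)) →
      (∀ c a : Fin (2*l), c ≠ revF l a → (x c < x a ↔ y c < y a)) →
      ∀ a, (x a : ℕ) < l → l ≤ (y a : ℕ) → (x a : ℕ) + 1 = l ∧ (y a : ℕ) = l := by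
    intro x y hxs hys hlt' a h1 h2
    have : Finset.univ.filter (fun c => y c < y a) =
        insert (revF l a) (Finset.univ.filter (fun c => x c < x a)) := by
      ext c
      simp only [Finset.mem_filter_univ, Finset.mem_insert]
      by_cases hc : c = revF l a
      · simp [hc, hrev y hys, h2]
      · simp [hc, hlt' c a hc]
    have h3 := congrArg Finset.card this
    rw [Finset.card_insert_of_notMem
      (by simp only [Finset.mem_filter_univ]; rw [hrev x hxs]; omega), ← hcard, ← hcard] at h3
    omega
  have hflip : ∀ (x y : Equiv.Perm (Fin (2*l))), (∀ i, x (revF l i) = revF l (x i)) →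
      (∀ i, y (revF l i) = revF l (y i)) →
      (∀ c a : Fin (2*l), c ≠ revF l a → (x c < x a ↔ y c < y a)) →
      (∀ a, (l ≤ (x a : ℕ) ↔ l ≤ (y a : ℕ)) → x a = y a) →
      Even (Finset.univ.filter (fun i : Fin (2*l) => (i:ℕ) < l ∧ l ≤ (x i : ℕ))).card →
      Even (Finset.univ.filter (fun i : Fin (2*l) => (i:ℕ) < l ∧ l ≤ (y i : ℕ))).card →
      ∀ a : Fin (2*l), (a:ℕ) < l → (x a : ℕ) < l → l ≤ (y a : ℕ) → False := by
    intro x y hxs hys hlt' hsame hxe hye a hal h1 h2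
    obtain ⟨h3, h4⟩ := hdiff x y hxs hys hlt' a h1 h2
    have : Finset.univ.filter (fun i : Fin (2*l) => (i:ℕ) < l ∧ l ≤ (y i : ℕ)) =
        insert a (Finset.univ.filter (fun i : Fin (2*l) => (i:ℕ) < l ∧ l ≤ (x i : ℕ))) := by
      ext c
      simp only [Finset.mem_filter_univ, Finset.mem_insert]
      by_cases hc : c = a
      · simp [hc, hal, h2]
      simp only [hc, false_or, and_congr_right_iff]
      intro hcl
      by_contra hne
      have hxy : ((x c : ℕ) < l ∧ l ≤ (y c : ℕ)) ∨ ((y c : ℕ) < l ∧ l ≤ (x c : ℕ)) := by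
        omega
      rcases hxy with ⟨h5, h6⟩ | ⟨h5, h6⟩
      · have := (hdiff x y hxs hys hlt' c h5 h6).2
        exact hc (y.injective (Fin.ext (by omega)))
      · have h7 := hdiff y x hys hxs (fun c a h => (hlt' c a h).symm) c h5 h6
        have h8 : c = revF l a := x.injective (by
          rw [hxs]; ext; rw [revF_val]; omega)
        rw [h8, revF_val] at hcl
        omega
    rw [this, Finset.card_insert_of_notMem (by simp; omega)] at hye
    exact (Nat.even_add_one.1 hye) hxe
  have hlow : ∀ a : Fin (2*l), (a:ℕ) < l → x a = y a := by
    intro a hal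
    refine hsame a ?_
    by_contra hne
    rcases lt_or_ge (x a : ℕ) l with h1 | h1
    · exact hflip x y hxs hys hlt' hsame hxe hye a hal h1 (by omega)
    · exact hflip y x hys hxs (fun c a h => (hlt' c a h).symm)
        (fun a h => (hsame a h.symm).symm) hye hxe a hal (by omega) h1
  ext a
  by_cases hal : (a:ℕ) < l
  · rw [hlow a hal]
  · have := hlow (revF l a) (by rw [revF_val]; omega)
    rw [hxs, hys] at this
    rw [← revF_revF (x a), this, revF_revF]

/-! ### Length -/

lemma lenD_mul_refl_lt {x s : Equiv.Perm (Fin (2*l))} {γ : Fin l → ℤ} (hx : IsSigned x)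
    (hs : IsSigned s) (hss : s * s = 1) (hγ : isPosRootD l γ) (hsγ : actD l s γ = -γ)
    (hm : ∀ v, ∃ m : ℤ, actD l s v = v - m • γ) (hneg : isPosRootD l (-actD l x γ))
    {h : (Fin l → ℤ) →+ ℤ} (hpos : ∀ v, isPosRootD l v → 0 < h v) :
    lenD l (x * s) < lenD l x := by
  have hinv : ∀ v, actD l s (actD l s v) = v := fun v => by
    rw [← actD_mul hs, hss, actD_one]
  classical
  set f : (Fin l → ℤ) → (Fin l → ℤ) :=
    fun v => if isPosRootD l (actD l s v) then actD l s v else v with hf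
  have hfin : {v | isPosRootD l v ∧ isNegRootD l (actD l x v)}.Finite :=
    finite_posRoots.subset fun v hv => hv.1
  have hmem : ∀ v, isPosRootD l v → isPosRootD l (-actD l x (actD l s v)) →
      isPosRootD l (f v) ∧ isPosRootD l (-actD l x (f v)) := by
    intro v hv hxv
    by_cases hsv : isPosRootD l (actD l s v)
    · simp only [hf, if_pos hsv]
      exact ⟨hsv, hxv⟩
    · simp only [hf, if_neg hsv]
      refine ⟨hv, ?_⟩
      have hsv' := (hv.actD hs).resolve_left hsv
      obtain ⟨m, hm⟩ := hm v
      have h1 := hpos _ hv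
      have h2 := hpos _ hsv'
      have h3 := hpos _ hγ
      rw [hm, map_neg, map_sub, map_zsmul, smul_eq_mul] at h2
      have hmpos : 0 < m := by
        by_contra hle
        nlinarith
      refine (hv.actD hx).resolve_left fun hxv' => ?_
      have h4 := hpos _ hxv'
      have h5 := hpos _ hxv
      have h6 := hpos _ hneg
      rw [hm, actD_sub, actD_zsmul, map_neg, map_sub, map_zsmul, smul_eq_mul] at h5
      rw [map_neg] at h6
      nlinarith
  unfold lenD
  have himg : f '' {v | isPosRootD l v ∧ isNegRootD l (actD l (x * s) v)} ⊂
      {v | isPosRootD l v ∧ isNegRootD l (actD l x v)} := by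
    refine ⟨?_, fun hsub => ?_⟩
    · rintro _ ⟨v, ⟨hv, hxv⟩, rfl⟩
      rw [isNegRootD_iff, actD_mul hx] at hxv
      simp only [Set.mem_ofPred_eq, isNegRootD_iff]
      exact hmem v hv hxv
    · obtain ⟨v, ⟨hv, hxv⟩, hfv⟩ := hsub (show γ ∈ _ from ⟨hγ, (isNegRootD_iff _).2 hneg⟩)
      rw [isNegRootD_iff, actD_mul hx] at hxv
      by_cases hsv : isPosRootD l (actD l s v)
      · simp only [hf, if_pos hsv] at hfv
        have := hinv v
        rw [hfv, hsγ] at this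
        rw [← this] at hv
        exact hγ.not_neg hv
      · simp only [hf, if_neg hsv] at hfv
        rw [hfv, hsγ, actD_neg, neg_neg] at hxv
        exact hxv.not_neg hneg
  rw [← Set.InjOn.ncard_image (f := f)]
  · exact Set.ncard_lt_ncard himg hfin
  · rintro v ⟨hv, -⟩ w ⟨hw, -⟩ hvw
    simp only [hf] at hvw
    split_ifs at hvw with h1 h2 h2
    · rw [← hinv v, hvw, hinv]
    · rw [← hvw, hinv] at h2
      exact absurd hv h2
    · rw [hvw, hinv] at h1
      exact absurd hw h1
    · exact hvw

/-! ### Elements of `w₀ W_θ` -/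

/-- `d` is a family of functionals dual, up to positive scalars, to the simple roots. -/
def IsDual (d : (Fin l → ℤ) → (Fin l → ℤ) →+ ℤ) : Prop :=
  ∀ α ∈ simpleSetD l, 0 < d α α ∧ ∀ β ∈ simpleSetD l, β ≠ α → d α β = 0

/-- `v` has no component along the simple roots outside `θ`. -/
def InSpan (d : (Fin l → ℤ) → (Fin l → ℤ) →+ ℤ) (θ : Set (Fin l → ℤ)) (v : Fin l → ℤ) : Prop :=
  ∀ β ∈ simpleSetD l, β ∉ θ → d β v = 0

/-- `x` sends every positive root outside the span of `θ` to a negative root; this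
characterizes the coset `w₀ W_θ`. -/
def InLongCoset (d : (Fin l → ℤ) → (Fin l → ℤ) →+ ℤ) (θ : Set (Fin l → ℤ))
    (x : Equiv.Perm (Fin (2*l))) : Prop :=
  ∀ γ, isPosRootD l γ → ¬ InSpan d θ γ → isPosRootD l (-actD l x γ)

lemma exists_pos_height (hl : 2 ≤ l) : ∃ h : (Fin l → ℤ) →+ ℤ,
    (∀ α ∈ simpleSetD l, h α = 1) ∧ ∀ v, isPosRootD l v → 0 < h v := by
  obtain ⟨h, hh⟩ := exists_height hl
  refine ⟨h, hh, fun v hv => ?_⟩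
  have key : ∀ v ∈ AddSubmonoid.closure (simpleSetD l), v = 0 ∨ 0 < h v := by
    intro v hv
    induction hv using AddSubmonoid.closure_induction with
    | mem x hx => rw [hh x hx]; simp
    | zero => simp
    | add x y _ _ hx hy =>
      rcases hx with rfl | hx
      · simpa using hy
      · rcases hy with rfl | hy
        · simpa using Or.inr hx
        · exact Or.inr (by rw [map_add]; omega)
  refine (key v hv.mem_closure).resolve_left ?_
  rintro rfl
  exact hv.not_neg (by simpa using hv)

variable {d : (Fin l → ℤ) → (Fin l → ℤ) →+ ℤ} {θ : Set (Fin l → ℤ)}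
  {x y : Equiv.Perm (Fin (2*l))}

lemma IsDual.nonneg (hd : IsDual d) {α v : Fin l → ℤ} (hα : α ∈ simpleSetD l)
    (hv : v ∈ AddSubmonoid.closure (simpleSetD l)) : 0 ≤ d α v := by
  induction hv using AddSubmonoid.closure_induction with
  | mem x hx =>
    by_cases h : x = α
    · rw [h]; exact (hd α hα).1.le
    · exact ((hd α hα).2 x hx h).ge
  | zero => simp
  | add x y _ _ hx hy => rw [map_add]; omega

lemma IsDual.mem_closure (hd : IsDual d) {v : Fin l → ℤ}
    (hv : v ∈ AddSubmonoid.closure (simpleSetD l)) (hs : InSpan d θ v) :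
    v ∈ AddSubmonoid.closure θ := by
  induction hv using AddSubmonoid.closure_induction with
  | mem x hx =>
    refine AddSubmonoid.subset_closure ?_
    by_contra h
    exact (hd x hx).1.ne' (hs x hx h)
  | zero => exact zero_mem _
  | add x y hx' hy' hx hy =>
    refine add_mem (hx fun β hβ hβθ => ?_) (hy fun β hβ hβθ => ?_) <;>
    · have h1 := hs β hβ hβθ
      have h2 := hd.nonneg hβ hx'
      have h3 := hd.nonneg hβ hy'
      rw [map_add] at h1
      omega

lemma IsDual.inSpan_of_mem (hd : IsDual d) (hθ : θ ⊆ simpleSetD l) {α : Fin l → ℤ}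
    (hα : α ∈ θ) : InSpan d θ α := fun β hβ hβθ =>
  (hd β hβ).2 α (hθ hα) (by rintro rfl; exact hβθ hα)

lemma IsDual.mem_of_inSpan (hd : IsDual d) {α : Fin l → ℤ} (hα : α ∈ simpleSetD l)
    (h : InSpan d θ α) : α ∈ θ := by
  by_contra hαθ
  exact (hd α hα).1.ne' (h α hα hαθ)

lemma InLongCoset.mul_refl (hd : IsDual d) (hx : IsSigned x) (hg : InLongCoset d θ x)
    {γ : Fin l → ℤ} (hγs : InSpan d θ γ) {s : Equiv.Perm (Fin (2*l))} (hs : IsSigned s)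
    (hm : ∀ v, ∃ m : ℤ, actD l s v = v - m • γ) : InLongCoset d θ (x * s) := by
  intro δ hδ hδs
  rw [actD_mul hx]
  obtain ⟨m, hm⟩ := hm δ
  have hdd : ∀ β ∈ simpleSetD l, β ∉ θ → d β (actD l s δ) = d β δ := fun β hβ hβθ => by
    rw [hm, map_sub, map_zsmul, hγs β hβ hβθ]; simp
  have hns : ¬ InSpan d θ (actD l s δ) := fun h => hδs fun β hβ hβθ => by
    rw [← hdd β hβ hβθ, h β hβ hβθ]
  refine hg _ ((hδ.actD hs).resolve_right fun hneg => hδs fun β hβ hβθ => ?_) hns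
  have h1 := hd.nonneg hβ hneg.mem_closure
  have h2 := hd.nonneg hβ hδ.mem_closure
  rw [map_neg, hdd β hβ hβθ] at h1
  omega

lemma pos_of_inSpan (hl : 2 ≤ l) (hd : IsDual d) (hx : IsSigned x)
    (hp : ∀ α ∈ θ, isPosRootD l (actD l x α)) {γ : Fin l → ℤ} (hγ : isPosRootD l γ)
    (hs : InSpan d θ γ) : isPosRootD l (actD l x γ) := by
  obtain ⟨h, -, hpos⟩ := exists_pos_height hl
  have key : ∀ v ∈ AddSubmonoid.closure θ, 0 ≤ h (actD l x v) := by
    intro v hv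
    induction hv using AddSubmonoid.closure_induction with
    | mem v hv => exact (hpos _ (hp v hv)).le
    | zero => simp [actD_zero]
    | add v w _ _ hv hw => rw [actD_add, map_add]; omega
  refine (hγ.actD hx).resolve_right fun hneg => ?_
  have h1 := key γ (hd.mem_closure hγ.mem_closure hs)
  have h2 := hpos _ hneg
  rw [map_neg] at h2
  omega

lemma inLongCoset_thetaD (hl : 2 ≤ l) (hd : IsDual d) (hx : inBesselD l x) :
    InLongCoset d (thetaD l x) x := by
  obtain ⟨hxw, hxB⟩ := hx
  have hxs : IsSigned x := hxw.1
  have hsimple : ∀ α ∈ thetaD l x, actD l x α ∈ simpleSetD l := fun α hα =>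
    (hxB α hα.1).resolve_left fun h => hα.2.not_neg ((isNegRootD_iff _).1 h)
  have hneg : ∀ α ∈ simpleSetD l, α ∉ thetaD l x → isPosRootD l (-actD l x α) :=
    fun α hα hαθ => ((isPosRootD_of_mem_simpleSetD hl hα).actD hxs).resolve_left
      fun h => hαθ ⟨hα, h⟩
  -- A simple root outside `θ` has a strictly negative image modulo the span of `x θ`.
  have hδ : ∀ β ∈ simpleSetD l, β ∉ thetaD l x → ∃ δ ∈ simpleSetD l,
      δ ∉ actD l x '' thetaD l x ∧ d δ (actD l x β) < 0 := by
    intro β hβ hβθ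
    by_contra! hcon
    have hcl := (hneg β hβ hβθ).mem_closure
    have hspan : InSpan d (actD l x '' thetaD l x) (-actD l x β) := fun δ hδ hδθ => by
      have h1 := hcon δ hδ hδθ
      have h2 := hd.nonneg hδ hcl
      rw [map_neg] at h2 ⊢
      omega
    have hmem := hd.mem_closure hcl hspan
    have hinv : ∀ v ∈ AddSubmonoid.closure (actD l x '' thetaD l x),
        d β (actD l x⁻¹ v) = 0 := by
      intro v hv
      induction hv using AddSubmonoid.closure_induction with
      | mem v hv =>
        obtain ⟨α, hα, rfl⟩ := hv
        rw [actD_inv_actD hxs]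
        exact (hd β hβ).2 α hα.1 (by rintro rfl; exact hβθ hα)
      | zero => simp [actD_zero]
      | add v w _ _ hv hw => rw [actD_add, map_add, hv, hw, add_zero]
    have h1 := hinv _ hmem
    rw [actD_neg, actD_inv_actD hxs, map_neg] at h1
    have := (hd β hβ).1
    omega
  intro γ hγ hγs
  simp only [InSpan, not_forall] at hγs
  obtain ⟨β, hβ, hβθ, hβγ⟩ := hγs
  obtain ⟨δ, hδΔ, hδθ, hδβ⟩ := hδ β hβ hβθ
  have key : ∀ v ∈ AddSubmonoid.closure (simpleSetD l),
      d δ (actD l x v) ≤ 0 ∧ (d β v ≠ 0 → d δ (actD l x v) < 0) := by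
    intro v hv
    induction hv using AddSubmonoid.closure_induction with
    | mem v hv =>
      refine ⟨?_, fun hne => ?_⟩
      · by_cases hvθ : v ∈ thetaD l x
        · exact ((hd δ hδΔ).2 _ (hsimple v hvθ) fun h => hδθ ⟨v, hvθ, h⟩).le
        · have := hd.nonneg hδΔ (hneg v hv hvθ).mem_closure
          rw [map_neg] at this
          omega
      · have hvβ : v = β := by
          by_contra h
          exact hne ((hd β hβ).2 v hv h)
        rwa [hvβ]
    | zero => simp [actD_zero]
    | add v w _ _ hv hw =>
      rw [actD_add, map_add, map_add]
      refine ⟨by omega, fun hne => ?_⟩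
      by_cases h : d β v = 0
      · have := hw.2 (by omega)
        omega
      · have := hv.2 h
        omega
  refine (hγ.actD hxs).resolve_left fun hpos => ?_
  have h1 := hd.nonneg hδΔ hpos.mem_closure
  have h2 := (key γ hγ.mem_closure).2 hβγ
  omega

lemma exists_minimal (hl : 2 ≤ l) (hd : IsDual d) (hθ : θ ⊆ simpleSetD l) (hx : inWeylD l x)
    (hg : InLongCoset d θ x) : ∃ y, inWeylD l y ∧ InLongCoset d θ y ∧
      (∀ α ∈ θ, isPosRootD l (actD l y α)) ∧ bruhatLE l y x := by
  obtain ⟨h, -, hpos⟩ := exists_pos_height hl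
  induction hn : lenD l x using Nat.strong_induction_on generalizing x with
  | _ n ih =>
    by_cases hp : ∀ α ∈ θ, isPosRootD l (actD l x α)
    · exact ⟨x, hx, hg, hp, Relation.ReflTransGen.refl⟩
    push Not at hp
    obtain ⟨α, hα, hαn⟩ := hp
    have hαp := isPosRootD_of_mem_simpleSetD hl (hθ hα)
    have hneg := (hαp.actD hx.1).resolve_left hαn
    obtain ⟨s, hss, hs, hsα, hm, hw, ht⟩ := exists_refl hαp
    have hlt := lenD_mul_refl_lt hx.1 hs hss hαp hsα hm hneg hpos
    obtain ⟨y, hy, hyg, hyp, hyle⟩ := ih _ (hn ▸ hlt) (hw x hx)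
      (hg.mul_refl hd hx.1 (hd.inSpan_of_mem hθ hα) hs hm) rfl
    obtain ⟨t, htr, ht⟩ := ht (x * s) (hw x hx).1
    refine ⟨y, hy, hyg, hyp, hyle.tail ⟨⟨t, htr, ?_⟩, hlt⟩⟩
    rw [ht, mul_assoc, hss, mul_one]

lemma eq_of_minimal (hl : 2 ≤ l) (hd : IsDual d) (hx : inWeylD l x) (hy : inWeylD l y)
    (hxg : InLongCoset d θ x) (hyg : InLongCoset d θ y)
    (hxp : ∀ α ∈ θ, isPosRootD l (actD l x α)) (hyp : ∀ α ∈ θ, isPosRootD l (actD l y α)) :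
    x = y := by
  refine eq_of_pos_iff hx hy fun γ hγ => ?_
  by_cases hs : InSpan d θ γ
  · exact iff_of_true (pos_of_inSpan hl hd hx.1 hxp hγ hs) (pos_of_inSpan hl hd hy.1 hyp hγ hs)
  · exact iff_of_false (fun h => h.not_neg (hxg γ hγ hs)) (fun h => h.not_neg (hyg γ hγ hs))

lemma thetaD_of_minimal (hd : IsDual d) (hθ : θ ⊆ simpleSetD l) (hg : InLongCoset d θ x)
    (hp : ∀ α ∈ θ, isPosRootD l (actD l x α)) (hl : 2 ≤ l) : thetaD l x = θ := by
  ext α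
  refine ⟨fun hα => hd.mem_of_inSpan hα.1 ?_, fun hα => ⟨hθ hα, hp α hα⟩⟩
  by_contra hs
  exact hα.2.not_neg (hg α (isPosRootD_of_mem_simpleSetD hl hα.1) hs)

lemma inBesselD_of_minimal (hl : 2 ≤ l) (hd : IsDual d) (hx : inWeylD l x)
    (hg : InLongCoset d θ x) (hp : ∀ α ∈ θ, isPosRootD l (actD l x α)) : inBesselD l x := by
  obtain ⟨h, hh, hpos⟩ := exists_pos_height hl
  have hxs : IsSigned x := hx.1
  refine ⟨hx, fun α hα => ?_⟩
  have hαp := isPosRootD_of_mem_simpleSetD hl hα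
  rcases hαp.actD hxs with hpα | hnα
  swap
  · exact Or.inl ((isNegRootD_iff _).2 hnα)
  right
  -- The preimages of the summands in a decomposition of `x α` would both be positive.
  have aux : ∀ μ ν, isPosRootD l μ → isPosRootD l ν → actD l x α = μ + ν →
      ¬ isPosRootD l (-actD l x⁻¹ μ) := by
    intro μ ν hμ hν hsum hneg
    have hκs : ¬ InSpan d θ (-actD l x⁻¹ μ) := fun hs => by
      have := pos_of_inSpan hl hd hxs hp hneg hs
      rw [actD_neg, actD_actD_inv hxs] at this
      exact hμ.not_neg this
    have hν' : actD l x⁻¹ ν = α + -actD l x⁻¹ μ := by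
      rw [← actD_inv_actD hxs α, hsum, actD_add]; abel
    have hνp : isPosRootD l (actD l x⁻¹ ν) := (hν.actD hxs.inv).resolve_right fun hn => by
      have h1 := hpos _ hn
      have h2 := hpos _ hαp
      have h3 := hpos _ hneg
      rw [hν', map_neg, map_add] at h1
      omega
    have := hg _ hνp fun hs => hκs fun β hβ hβθ => by
      have h1 := hs β hβ hβθ
      have h2 := hd.nonneg hβ hαp.mem_closure
      have h3 := hd.nonneg hβ hneg.mem_closure
      rw [hν', map_add] at h1
      omega
    rw [actD_actD_inv hxs] at this
    exact hν.not_neg this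
  refine hpα.simple_or_add.resolve_right ?_
  rintro ⟨μ, ν, hμ, hν, hsum⟩
  have h1 := hpos _ ((hμ.actD hxs.inv).resolve_right (aux μ ν hμ hν hsum))
  have h2 := hpos _ ((hν.actD hxs.inv).resolve_right (aux ν μ hν hμ (by rw [hsum, add_comm])))
  have h3 : actD l x⁻¹ μ + actD l x⁻¹ ν = α := by
    rw [← actD_add, ← hsum, actD_inv_actD hxs]
  have h4 := hh α hα
  rw [← h3, map_add] at h4
  omega

lemma InLongCoset.of_bruhatLE (hl : 2 ≤ l) (hd : IsDual d) (hx : IsSigned x)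
    (hg : InLongCoset d θ x) (hxy : bruhatLE l x y) : IsSigned y ∧ InLongCoset d θ y := by
  obtain ⟨h, -, hpos⟩ := exists_pos_height hl
  induction hxy with
  | refl => exact ⟨hx, hg⟩
  | tail _ hstep ih =>
    obtain ⟨hbs, hbg⟩ := ih
    obtain ⟨⟨t, ht, rfl⟩, hlt⟩ := hstep
    obtain ⟨γ, s, hγ, hts, hss, hs, hsγ, hm⟩ := exists_refl_of_isReflD ht hbs
    rw [hts] at hlt ⊢
    refine ⟨hbs.mul hs, hbg.mul_refl hd hbs ?_ hs hm⟩
    by_contra hns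
    exact (lenD_mul_refl_lt hbs hs hss hγ hsγ hm (hbg γ hγ hns) hpos).not_gt hlt

/-- The long element. -/
lemma exists_long (hl : 2 ≤ l) : ∃ w, inWeylD l w ∧
    ∀ γ, isPosRootD l γ → isPosRootD l (-actD l w γ) := by
  obtain ⟨h, -, hpos⟩ := exists_pos_height hl
  have hone : inWeylD l (1 : Equiv.Perm (Fin (2*l))) := by
    refine ⟨fun i => rfl, ?_⟩
    rw [Finset.filter_false_of_mem]
    · simp
    · intro i _; simp
  obtain ⟨w, hw, hmax⟩ := Set.exists_max_image {w | inWeylD l w} (lenD l) (Set.toFinite _)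
    ⟨1, hone⟩
  refine ⟨w, hw, fun γ hγ => (hγ.actD hw.1).resolve_left fun hp => ?_⟩
  obtain ⟨s, hss, hs, hsγ, hm, hws, -⟩ := exists_refl hγ
  have hlt := lenD_mul_refl_lt (hws w hw).1 hs hss hγ hsγ hm
    (by rwa [actD_mul hw.1, hsγ, actD_neg, neg_neg]) hpos
  rw [mul_assoc, hss, mul_one] at hlt
  exact (hmax _ (hws w hw)).not_gt hlt

end WeylD

open WeylD

/-- `w ↦ θ_w` is a bijection from the Bessel support `B(SO_{2l})` onto the
power set of the set of simple roots, and for `w, w' ∈ B(SO_{2l})`: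
`w' ≤ w` in the Bruhat order iff `θ_w ⊆ θ_{w'}`. -/
theorem statement12 (l : ℕ) (hl : 2 ≤ l) :
    Set.BijOn (thetaD l) {σ | inBesselD l σ} {S | S ⊆ simpleSetD l} ∧
    ∀ σ ∈ {σ | inBesselD l σ}, ∀ τ ∈ {σ | inBesselD l σ},
      (bruhatLE l τ σ ↔ thetaD l σ ⊆ thetaD l τ) := by
  obtain ⟨d, hd : IsDual d⟩ := exists_dual hl
  refine ⟨⟨fun σ _ α hα => hα.1, ?_, ?_⟩, ?_⟩
  · intro σ hσ τ hτ (h : thetaD l σ = thetaD l τ)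
    have hτg := inLongCoset_thetaD hl hd hτ
    rw [← h] at hτg
    exact eq_of_minimal hl hd hσ.1 hτ.1 (inLongCoset_thetaD hl hd hσ) hτg
      (fun α hα => hα.2) (fun α hα => (h ▸ hα : α ∈ thetaD l τ).2)
  · intro θ hθ
    obtain ⟨w, hw, hneg⟩ := exists_long hl
    obtain ⟨x, hx, hg, hp, -⟩ := exists_minimal hl hd hθ hw (fun γ hγ _ => hneg γ hγ)
    exact ⟨x, inBesselD_of_minimal hl hd hx hg hp, thetaD_of_minimal hd hθ hg hp hl⟩
  · intro σ hσ τ hτ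
    have hθ : thetaD l τ ⊆ simpleSetD l := fun α hα => hα.1
    constructor
    · intro hle α hα
      have hg := (InLongCoset.of_bruhatLE hl hd hτ.1.1 (inLongCoset_thetaD hl hd hτ) hle).2
      refine hd.mem_of_inSpan hα.1 ?_
      by_contra hs
      exact hα.2.not_neg (hg α (isPosRootD_of_mem_simpleSetD hl hα.1) hs)
    · intro hsub
      have hg : InLongCoset d (thetaD l τ) σ := fun γ hγ hs =>
        inLongCoset_thetaD hl hd hσ γ hγ fun h => hs fun β hβ hβτ =>
          h β hβ fun hβσ => hβτ (hsub hβσ)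
      obtain ⟨x, hx, hxg, hxp, hle⟩ := exists_minimal hl hd hθ hσ.1 hg
      rwa [eq_of_minimal hl hd hx hτ.1 hxg (inLongCoset_thetaD hl hd hτ) hxp
        (fun α hα => hα.2)] at hle

end
end

section
/- The sets B_n(SO_{2l}) for n = 0,1,…,l together with B_l^c(SO_{2l}) form a partition of the Bessel support B(SO_{2l}). -/
noncomputable section

/-- An explicit permutation of `Fin N` built from an involutive function on `ℕ`. -/
def natPerm (N : ℕ) (g : ℕ → ℕ) (h1 : ∀ x, x < N → g x < N)
    (h2 : ∀ x, x < N → g (g x) = x) : Equiv.Perm (Fin N) where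
  toFun := fun i => ⟨g i, h1 i i.isLt⟩
  invFun := fun i => ⟨g i, h1 i i.isLt⟩
  left_inv := fun i => Fin.ext (h2 i i.isLt)
  right_inv := fun i => Fin.ext (h2 i i.isLt)

/-- The underlying function of the Weyl representative `w̃_n`. -/
def wtnFun (l n : ℕ) (x : ℕ) : ℕ :=
  if x < n then x + (2*l - n)
  else if 2*l - n ≤ x then x - (2*l - n)
  else if n % 2 = 1 ∧ x = l - 1 then l
  else if n % 2 = 1 ∧ x = l then l - 1
  else x

lemma wtnFun_lt (l n : ℕ) (h : n + 1 ≤ l) : ∀ x, x < 2*l → wtnFun l n x < 2*l := by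
  intro x hx; unfold wtnFun; split_ifs <;> omega

lemma wtnFun_invol (l n : ℕ) (h : n + 1 ≤ l) : ∀ x, x < 2*l → wtnFun l n (wtnFun l n x) = x := by
  intro x hx; unfold wtnFun; split_ifs <;> omega

/-- The Weyl representative `w̃_n` as a permutation of `Fin (2l)`:
`I_n` corners, `J_2^n` center. -/
def wtnPerm (l n : ℕ) : Equiv.Perm (Fin (2*l)) :=
  if h : n + 1 ≤ l then natPerm (2*l) (wtnFun l n) (wtnFun_lt l n h) (wtnFun_invol l n h)
  else 1

def shFun (l x : ℕ) : ℕ := if x < l then x + l else x - l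

lemma shFun_lt (l : ℕ) : ∀ x, x < 2*l → shFun l x < 2*l := by
  intro x hx; unfold shFun; split_ifs <;> omega

lemma shFun_invol (l : ℕ) : ∀ x, x < 2*l → shFun l (shFun l x) = x := by
  intro x hx; unfold shFun; split_ifs <;> omega

/-- The permutation swapping the two halves of `Fin (2l)` (the element `[[0,I_l],[I_l,0]]`). -/
def shPerm (l : ℕ) : Equiv.Perm (Fin (2*l)) := natPerm (2*l) (shFun l) (shFun_lt l) (shFun_invol l)

def cswapFun (l x : ℕ) : ℕ := if x = l - 1 then l else if x = l then l - 1 else x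

lemma cswapFun_lt (l : ℕ) : ∀ x, x < 2*l → cswapFun l x < 2*l := by
  intro x hx; unfold cswapFun; split_ifs <;> omega

lemma cswapFun_invol (l : ℕ) : ∀ x, x < 2*l → cswapFun l (cswapFun l x) = x := by
  intro x hx; unfold cswapFun; split_ifs <;> omega

/-- The outer automorphism `c`: the transposition of `l-1` and `l` (0-indexed). -/
def cswapPerm (l : ℕ) : Equiv.Perm (Fin (2*l)) :=
  natPerm (2*l) (cswapFun l) (cswapFun_lt l) (cswapFun_invol l)

def endSwapFun (l x : ℕ) : ℕ := if x = 0 then 2*l - 1 else if x = 2*l - 1 then 0 else x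

lemma endSwapFun_lt (l : ℕ) : ∀ x, x < 2*l → endSwapFun l x < 2*l := by
  intro x hx; unfold endSwapFun; split_ifs <;> omega

lemma endSwapFun_invol (l : ℕ) : ∀ x, x < 2*l → endSwapFun l (endSwapFun l x) = x := by
  intro x hx; unfold endSwapFun; split_ifs <;> omega

def endSwapPerm (l : ℕ) : Equiv.Perm (Fin (2*l)) :=
  natPerm (2*l) (endSwapFun l) (endSwapFun_lt l) (endSwapFun_invol l)

/-- The Weyl representative `w̃_l` (with `θ_{w̃_l} = Δ ∖ {α_l}`): for `l` even the
half-swap `w̃'_l = [[0,I_l],[I_l,0]]`, and for `l` odd its conjugate by `c`. -/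
def wtlPerm (l : ℕ) : Equiv.Perm (Fin (2*l)) :=
  if l % 2 = 1 then cswapPerm l * (shPerm l * endSwapPerm l) * cswapPerm l else shPerm l

/-- `w̃_l^c = c w̃_l c`. -/
def wtlcPerm (l : ℕ) : Equiv.Perm (Fin (2*l)) := cswapPerm l * wtlPerm l * cswapPerm l

def wlongGLFun (l x : ℕ) : ℕ := if x < l then l - 1 - x else 3*l - 1 - x

lemma wlongGLFun_lt (l : ℕ) : ∀ x, x < 2*l → wlongGLFun l x < 2*l := by
  intro x hx; unfold wlongGLFun; split_ifs <;> omega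

lemma wlongGLFun_invol (l : ℕ) : ∀ x, x < 2*l → wlongGLFun l (wlongGLFun l x) = x := by
  intro x hx; unfold wlongGLFun; split_ifs <;> omega

/-- The long Weyl element of the Siegel Levi `L_l ≅ GL_l`, i.e. `t_l(J_l)`. -/
def wlongGLPerm (l : ℕ) : Equiv.Perm (Fin (2*l)) :=
  natPerm (2*l) (wlongGLFun l) (wlongGLFun_lt l) (wlongGLFun_invol l)

def wlongGLm1Fun (l x : ℕ) : ℕ :=
  if x < l - 1 then l - 2 - x else if l + 1 ≤ x then 3*l - x else x

lemma wlongGLm1Fun_lt (l : ℕ) : ∀ x, x < 2*l → wlongGLm1Fun l x < 2*l := by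
  intro x hx; unfold wlongGLm1Fun; split_ifs <;> omega

lemma wlongGLm1Fun_invol (l : ℕ) : ∀ x, x < 2*l → wlongGLm1Fun l (wlongGLm1Fun l x) = x := by
  intro x hx; unfold wlongGLm1Fun; split_ifs <;> omega

/-- The long Weyl element of the Levi `L_{l-1,1} ≅ GL_{l-1} × GL_1`. -/
def wlongGLm1Perm (l : ℕ) : Equiv.Perm (Fin (2*l)) :=
  natPerm (2*l) (wlongGLm1Fun l) (wlongGLm1Fun_lt l) (wlongGLm1Fun_invol l)

def wlongLnFun (l n x : ℕ) : ℕ :=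
  if x < n then n - 1 - x else if 2*l - n ≤ x then 4*l - 1 - n - x else x

lemma wlongLnFun_lt (l n : ℕ) (h : n ≤ l) : ∀ x, x < 2*l → wlongLnFun l n x < 2*l := by
  intro x hx; unfold wlongLnFun; split_ifs <;> omega

lemma wlongLnFun_invol (l n : ℕ) (h : n ≤ l) :
    ∀ x, x < 2*l → wlongLnFun l n (wlongLnFun l n x) = x := by
  intro x hx; unfold wlongLnFun; split_ifs <;> omega

/-- The long Weyl element of the Levi `L_{n,1^{l-n}} ≅ GL_n × GL_1^{l-n}`. -/
def wlongLnPerm (l n : ℕ) : Equiv.Perm (Fin (2*l)) :=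
  if h : n ≤ l then natPerm (2*l) (wlongLnFun l n) (wlongLnFun_lt l n h) (wlongLnFun_invol l n h)
  else 1

/-- `τ` is the image `t_n(w')` of an element `w'` of the Weyl group `W(GL_n)`:
it preserves the first block `{0,…,n-1}`, fixes the middle `[n, 2l-n)` pointwise, and
commutes with `rev`. -/
def isGLnBlock (l n : ℕ) (τ : Equiv.Perm (Fin (2*l))) : Prop :=
  (∀ i : Fin (2*l), (i:ℕ) < n → ((τ i : Fin (2*l)) : ℕ) < n) ∧
  (∀ i : Fin (2*l), n ≤ (i:ℕ) → (i:ℕ) < 2*l - n → τ i = i) ∧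
  (∀ i, τ (revF l i) = revF l (τ i))

/-- The classes of the partition of the Bessel support:
`idx ≤ l-2` : `B_idx = {w ∈ B : w = t_idx(w') w̃_idx}`;
`idx = l-1` : `B_{l-1} = {w ∈ B : w = t_l(w') w̃_l, cwc = w}`;
`idx = l`   : `B_l = {w ∈ B : w = t_l(w') w̃_l, cwc ≠ w}`;
`idx = l+1` : `B_l^c = {cwc : w ∈ B_l}`. -/
def besselClass (l : ℕ) (idx : ℕ) : Set (Equiv.Perm (Fin (2*l))) :=
  if idx ≤ l - 2 then
    {σ | inBesselD l σ ∧ ∃ τ, isGLnBlock l idx τ ∧ σ = τ * wtnPerm l idx}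
  else if idx = l - 1 then
    {σ | inBesselD l σ ∧ (∃ τ, isGLnBlock l l τ ∧ σ = τ * wtlPerm l) ∧
      cswapPerm l * σ * cswapPerm l = σ}
  else if idx = l then
    {σ | inBesselD l σ ∧ (∃ τ, isGLnBlock l l τ ∧ σ = τ * wtlPerm l) ∧
      cswapPerm l * σ * cswapPerm l ≠ σ}
  else
    {σ | ∃ σ', (inBesselD l σ' ∧ (∃ τ, isGLnBlock l l τ ∧ σ' = τ * wtlPerm l) ∧
      cswapPerm l * σ' * cswapPerm l ≠ σ') ∧ σ = cswapPerm l * σ' * cswapPerm l}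

/-- The pairs `(x, y)` of indices for which the root `e_x - e_y` (with `e_{2l-1-x} = -e_x`)
is negative or simple. -/
def negOrSimplePair (l x y : ℕ) : Prop :=
  y < x ∨ y = x + 1 ∨ (x + 2 = l ∧ y = l) ∨ (x + 1 = l ∧ y = l + 1)

/-- The basis vector attached to an index below `2l`, with `e_{2l-1-x} = -e_x`. -/
def signedBasis (l x : ℕ) : Fin l → ℤ :=
  fun k => if x = (k : ℕ) then 1 else if x = 2 * l - 1 - (k : ℕ) then -1 else 0

lemma signedBasis_rev (l x : ℕ) (hx : x < 2 * l) :
    signedBasis l (2 * l - 1 - x) = -signedBasis l x := by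
  funext k
  have := k.isLt
  simp only [signedBasis, Pi.neg_apply]
  split_ifs <;> omega

lemma negOrSimplePair_of_isNegRootD {l x y : ℕ} (hx : x < 2 * l) (hy : y < 2 * l)
    (h : isNegRootD l (signedBasis l x - signedBasis l y)) : negOrSimplePair l x y := by
  obtain ⟨-, i, hi, hj⟩ := h
  have hil := i.isLt
  left
  by_contra hlt
  by_cases hxl : x < l
  · have h1 := hj ⟨x, hxl⟩
    simp only [signedBasis, Pi.sub_apply] at hi h1
    split_ifs at hi h1 <;> omega
  · have h1 := hj ⟨2 * l - 1 - y, by omega⟩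
    simp only [signedBasis, Pi.sub_apply] at hi h1
    split_ifs at hi h1 <;> omega

lemma negOrSimplePair_of_mem_simpleSetD {l x y : ℕ} (hl : 2 ≤ l)
    (h : signedBasis l x - signedBasis l y ∈ simpleSetD l) : negOrSimplePair l x y := by
  unfold negOrSimplePair
  rcases h with ⟨k, hk, h⟩ | h
  · have h1 := congrFun h ⟨k, by omega⟩
    have h2 := congrFun h ⟨k + 1, by omega⟩
    simp only [signedBasis, Pi.sub_apply] at h1 h2
    split_ifs at h1 h2 <;> omega
  · have h1 := congrFun h ⟨l - 2, by omega⟩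
    have h2 := congrFun h ⟨l - 1, by omega⟩
    simp only [signedBasis, Pi.sub_apply, true_or, or_true, if_true] at h1 h2
    split_ifs at h1 h2 <;> omega

lemma isRootD_signedBasis_sub {l x y : ℕ} (hx : x < 2 * l) (hy : y < 2 * l)
    (hxy : x ≠ y) (hr : x + y ≠ 2 * l - 1) :
    isRootD l (signedBasis l x - signedBasis l y) := by
  obtain ⟨i, hi, hxi⟩ : ∃ i, i < l ∧ (x = i ∨ x = 2 * l - 1 - i) := by
    by_cases h : x < l
    · exact ⟨x, h, Or.inl rfl⟩
    · exact ⟨2 * l - 1 - x, by omega, by omega⟩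
  obtain ⟨j, hj, hyj⟩ : ∃ j, j < l ∧ (y = j ∨ y = 2 * l - 1 - j) := by
    by_cases h : y < l
    · exact ⟨y, h, Or.inl rfl⟩
    · exact ⟨2 * l - 1 - y, by omega, by omega⟩
  rcases lt_or_gt_of_ne (show i ≠ j by omega) with hij | hij
  · refine ⟨⟨i, hi⟩, ⟨j, hj⟩, hij, if x = i then 1 else -1, if y = j then -1 else 1,
      by split_ifs <;> simp, by split_ifs <;> simp, ?_⟩
    funext k
    have := k.isLt
    simp only [signedBasis, Pi.sub_apply, Fin.ext_iff]
    split_ifs <;> omega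
  · refine ⟨⟨j, hj⟩, ⟨i, hi⟩, hij, if y = j then -1 else 1, if x = i then 1 else -1,
      by split_ifs <;> simp, by split_ifs <;> simp, ?_⟩
    funext k
    have := k.isLt
    simp only [signedBasis, Pi.sub_apply, Fin.ext_iff]
    split_ifs <;> omega

lemma isNegRootD_signedBasis_sub {l x y : ℕ} (hx : x < 2 * l) (hy : y < 2 * l)
    (hxy : y < x) (hr : x + y ≠ 2 * l - 1) :
    isNegRootD l (signedBasis l x - signedBasis l y) := by
  refine ⟨isRootD_signedBasis_sub hx hy (by omega) hr, ?_⟩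
  by_cases h : x + y < 2 * l - 1
  · refine ⟨⟨y, by omega⟩, ?_, fun j hj => ?_⟩
    · simp only [signedBasis, Pi.sub_apply]
      split_ifs <;> omega
    · have := j.isLt
      simp only at hj
      simp only [signedBasis, Pi.sub_apply]
      split_ifs <;> omega
  · refine ⟨⟨2 * l - 1 - x, by omega⟩, ?_, fun j hj => ?_⟩
    · simp only [signedBasis, Pi.sub_apply]
      split_ifs <;> omega
    · have := j.isLt
      simp only at hj
      simp only [signedBasis, Pi.sub_apply]
      split_ifs <;> omega

lemma isNegRootD_or_mem_simpleSetD_iff {l x y : ℕ} (hl : 2 ≤ l) (hx : x < 2 * l)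
    (hy : y < 2 * l) (hr : x + y ≠ 2 * l - 1) :
    (isNegRootD l (signedBasis l x - signedBasis l y) ∨
      signedBasis l x - signedBasis l y ∈ simpleSetD l) ↔ negOrSimplePair l x y := by
  constructor
  · rintro (h | h)
    · exact negOrSimplePair_of_isNegRootD hx hy h
    · exact negOrSimplePair_of_mem_simpleSetD hl h
  · rintro (h | h | h | h)
    · exact Or.inl (isNegRootD_signedBasis_sub hx hy h hr)
    · refine Or.inr (Or.inl ?_)
      by_cases hxl : x < l
      · refine ⟨x, by omega, ?_⟩
        funext j
        have := j.isLt
        simp only [signedBasis, Pi.sub_apply]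
        split_ifs <;> omega
      · refine ⟨2 * l - 1 - y, by omega, ?_⟩
        funext j
        have := j.isLt
        simp only [signedBasis, Pi.sub_apply]
        split_ifs <;> omega
    all_goals
      refine Or.inr (Or.inr ?_)
      funext j
      have := j.isLt
      simp only [signedBasis, Pi.sub_apply]
      split_ifs <;> omega

/-- A permutation of `Fin N` as a function on `ℕ`, extended by the identity. -/
def natFun {N : ℕ} (σ : Equiv.Perm (Fin N)) (x : ℕ) : ℕ :=
  if h : x < N then (σ ⟨x, h⟩ : ℕ) else x

section natFun

variable {N : ℕ}

lemma natFun_val (σ : Equiv.Perm (Fin N)) (i : Fin N) : natFun σ i = (σ i : ℕ) := by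
  simp [natFun]

lemma natFun_lt (σ : Equiv.Perm (Fin N)) {x : ℕ} (hx : x < N) : natFun σ x < N := by
  simp [natFun, hx]

lemma natFun_mul (σ τ : Equiv.Perm (Fin N)) (x : ℕ) :
    natFun (σ * τ) x = natFun σ (natFun τ x) := by
  by_cases h : x < N <;> simp [natFun, h]

lemma natFun_one (x : ℕ) : natFun (1 : Equiv.Perm (Fin N)) x = x := by
  simp [natFun]

lemma natFun_inv_natFun (σ : Equiv.Perm (Fin N)) (x : ℕ) : natFun σ⁻¹ (natFun σ x) = x := by
  rw [← natFun_mul, inv_mul_cancel, natFun_one]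

lemma natFun_natFun_inv (σ : Equiv.Perm (Fin N)) (x : ℕ) : natFun σ (natFun σ⁻¹ x) = x := by
  rw [← natFun_mul, mul_inv_cancel, natFun_one]

lemma natFun_injective (σ : Equiv.Perm (Fin N)) : Function.Injective (natFun σ) :=
  Function.LeftInverse.injective (natFun_inv_natFun σ)

lemma perm_ext_natFun {σ τ : Equiv.Perm (Fin N)} (h : ∀ x < N, natFun σ x = natFun τ x) :
    σ = τ := by
  ext i
  simpa only [natFun_val] using h i i.isLt

lemma natFun_natPerm (g : ℕ → ℕ) (h1 h2) {x : ℕ} (hx : x < N) :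
    natFun (natPerm N g h1 h2) x = g x := by
  simp [natFun, natPerm, hx]

end natFun

/-- Commutation with the order-reversing involution. -/
def CommutesRev (l : ℕ) (σ : Equiv.Perm (Fin (2 * l))) : Prop :=
  ∀ i, σ (revF l i) = revF l (σ i)

lemma commutesRev_iff {l : ℕ} {σ : Equiv.Perm (Fin (2 * l))} :
    CommutesRev l σ ↔ ∀ x < 2 * l, natFun σ (2 * l - 1 - x) = 2 * l - 1 - natFun σ x := by
  constructor
  · intro h x hx
    have := congrArg Fin.val (h ⟨x, hx⟩)
    rw [← natFun_val] at this
    simpa [revF, ← natFun_val] using this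
  · intro h i
    have := h i i.isLt
    apply Fin.ext
    rw [← natFun_val]
    simpa [revF, ← natFun_val] using this

lemma CommutesRev.mul {l : ℕ} {σ τ : Equiv.Perm (Fin (2 * l))} (hσ : CommutesRev l σ)
    (hτ : CommutesRev l τ) : CommutesRev l (σ * τ) := by
  intro i
  simp only [Equiv.Perm.mul_apply, hτ i, hσ (τ i)]

lemma CommutesRev.inv {l : ℕ} {σ : Equiv.Perm (Fin (2 * l))} (hσ : CommutesRev l σ) :
    CommutesRev l σ⁻¹ := by
  intro i
  apply σ.injective
  rw [hσ]
  simp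

lemma natFun_add_ne {l : ℕ} {σ : Equiv.Perm (Fin (2 * l))} (hσ : CommutesRev l σ) {x y : ℕ}
    (hx : x < 2 * l) (hy : y < 2 * l) (hxy : x + y ≠ 2 * l - 1) :
    natFun σ x + natFun σ y ≠ 2 * l - 1 := by
  intro h
  have h1 := commutesRev_iff.1 hσ x hx
  have h2 : natFun σ (2 * l - 1 - x) = natFun σ y := by
    have := natFun_lt σ hx
    omega
  have := natFun_injective σ h2
  omega

lemma actD_eq_sum (l : ℕ) (σ : Equiv.Perm (Fin (2 * l))) (v : Fin l → ℤ) :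
    actD l σ v = ∑ i : Fin l, v i • signedBasis l (natFun σ i) := by
  funext k
  simp only [actD, Finset.sum_apply, Pi.smul_apply, smul_eq_mul, signedBasis]
  refine Finset.sum_congr rfl fun i _ => ?_
  rw [← natFun_val]
  rfl

lemma actD_eq_of_two {l : ℕ} (σ : Equiv.Perm (Fin (2 * l))) {v : Fin l → ℤ} {i j : ℕ}
    (hi : i < l) (hj : j < l) (hij : i ≠ j)
    (hv : ∀ k : Fin l, (k : ℕ) ≠ i → (k : ℕ) ≠ j → v k = 0) :
    actD l σ v = v ⟨i, hi⟩ • signedBasis l (natFun σ i) +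
      v ⟨j, hj⟩ • signedBasis l (natFun σ j) := by
  rw [actD_eq_sum, Finset.sum_eq_add (⟨i, hi⟩ : Fin l) ⟨j, hj⟩ (by simpa using hij)]
  · rintro c - ⟨h1, h2⟩
    rw [hv c (by simpa [Fin.ext_iff] using h1) (by simpa [Fin.ext_iff] using h2), zero_smul]
  · simp
  · simp

lemma inBesselD_iff {l : ℕ} (hl : 2 ≤ l) (σ : Equiv.Perm (Fin (2 * l))) :
    inBesselD l σ ↔ inWeylD l σ ∧
      (∀ k, k + 2 ≤ l → negOrSimplePair l (natFun σ k) (natFun σ (k + 1))) ∧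
      negOrSimplePair l (natFun σ (l - 2)) (natFun σ l) := by
  unfold inBesselD
  refine and_congr_right fun hW => ?_
  have hc : CommutesRev l σ := hW.1
  have key {x y : ℕ} (hx : x < 2 * l) (hy : y < 2 * l) (hr : x + y ≠ 2 * l - 1) :=
    isNegRootD_or_mem_simpleSetD_iff hl (natFun_lt σ hx) (natFun_lt σ hy) (natFun_add_ne hc hx hy hr)
  have hdiff (k : ℕ) (hk : k + 2 ≤ l) : actD l σ (fun j : Fin l =>
      if (j : ℕ) = k then 1 else if (j : ℕ) = k + 1 then (-1 : ℤ) else 0) =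
      signedBasis l (natFun σ k) - signedBasis l (natFun σ (k + 1)) := by
    rw [actD_eq_of_two σ (i := k) (j := k + 1) (by omega) (by omega) (by omega)]
    · simp [sub_eq_add_neg]
    · intro j h1 h2
      simp [h1, h2]
  have hsum : actD l σ (fun j : Fin l =>
      if (j : ℕ) = l - 2 ∨ (j : ℕ) = l - 1 then (1 : ℤ) else 0) =
      signedBasis l (natFun σ (l - 2)) - signedBasis l (natFun σ l) := by
    rw [actD_eq_of_two σ (i := l - 2) (j := l - 1) (by omega) (by omega) (by omega)]
    · have h1 := commutesRev_iff.1 hc (l - 1) (by omega)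
      rw [show 2 * l - 1 - (l - 1) = l by omega] at h1
      rw [h1, signedBasis_rev _ _ (natFun_lt σ (by omega))]
      simp
    · intro j h1 h2
      simp [h1, h2]
  constructor
  · intro h
    refine ⟨fun k hk => ?_, ?_⟩
    · rw [← key (by omega) (by omega) (by omega), ← hdiff k hk]
      exact h _ (Or.inl ⟨k, hk, rfl⟩)
    · rw [← key (by omega) (by omega) (by omega), ← hsum]
      exact h _ (Or.inr rfl)
  · rintro ⟨h1, h2⟩ v (⟨k, hk, rfl⟩ | rfl)
    · rw [hdiff k hk, key (by omega) (by omega) (by omega)]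
      exact h1 k hk
    · rw [hsum, key (by omega) (by omega) (by omega)]
      exact h2

/-- The positions below `l` sent by `σ` to a position at least `l`. -/
def signChanges (l : ℕ) (σ : Equiv.Perm (Fin (2 * l))) : Finset ℕ :=
  (Finset.range l).filter fun i => l ≤ natFun σ i

lemma inWeylD_iff {l : ℕ} {σ : Equiv.Perm (Fin (2 * l))} :
    inWeylD l σ ↔ CommutesRev l σ ∧ Even (signChanges l σ).card := by
  unfold inWeylD CommutesRev
  suffices h : (Finset.univ.filter (fun i : Fin (2 * l) =>
      (i : ℕ) < l ∧ l ≤ ((σ i : Fin (2 * l)) : ℕ))).map Fin.valEmbedding = signChanges l σ by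
    rw [← h, Finset.card_map]
  ext x
  simp only [signChanges, Finset.mem_map, Finset.mem_filter, Finset.mem_univ, true_and,
    Finset.mem_range, Fin.valEmbedding_apply]
  constructor
  · rintro ⟨i, ⟨h1, h2⟩, rfl⟩
    exact ⟨h1, by rwa [natFun_val]⟩
  · rintro ⟨h1, h2⟩
    exact ⟨⟨x, by omega⟩, ⟨h1, by rwa [← natFun_val]⟩, rfl⟩

lemma le_natFun_iff_odd {l n : ℕ} {σ : Equiv.Perm (Fin (2 * l))} (hn : n + 1 ≤ l)
    (he : Even (signChanges l σ).card) (h1 : ∀ i < n, l ≤ natFun σ i)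
    (h2 : ∀ i, n ≤ i → i + 2 ≤ l → natFun σ i < l) : l ≤ natFun σ (l - 1) ↔ n % 2 = 1 := by
  by_cases h : l ≤ natFun σ (l - 1)
  · have : signChanges l σ = insert (l - 1) (Finset.range n) := by
      ext i
      simp only [signChanges, Finset.mem_filter, Finset.mem_range, Finset.mem_insert]
      rcases lt_or_ge i n with hi | hi
      · have := h1 i hi
        omega
      · rcases eq_or_ne i (l - 1) with rfl | hne
        · omega
        · have := h2 i hi
          omega
    rw [this, Finset.card_insert_of_notMem (by simp; omega), Finset.card_range,
      Nat.even_iff] at he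
    omega
  · have : signChanges l σ = Finset.range n := by
      ext i
      simp only [signChanges, Finset.mem_filter, Finset.mem_range]
      rcases lt_or_ge i n with hi | hi
      · have := h1 i hi
        omega
      · rcases eq_or_ne i (l - 1) with rfl | hne
        · omega
        · have := h2 i hi
          omega
    rw [this, Finset.card_range, Nat.even_iff] at he
    omega

/-- Conjugation by the outer automorphism. -/
def cconj (l : ℕ) (σ : Equiv.Perm (Fin (2 * l))) : Equiv.Perm (Fin (2 * l)) :=
  cswapPerm l * σ * cswapPerm l

lemma natFun_cswapPerm {l x : ℕ} (hx : x < 2 * l) : natFun (cswapPerm l) x = cswapFun l x :=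
  natFun_natPerm _ _ _ hx

lemma cswapPerm_mul_self (l : ℕ) : cswapPerm l * cswapPerm l = 1 := by
  refine perm_ext_natFun fun x hx => ?_
  rw [natFun_mul, natFun_cswapPerm hx, natFun_cswapPerm (cswapFun_lt l x hx),
    cswapFun_invol l x hx, natFun_one]

lemma cconj_cconj (l : ℕ) (σ : Equiv.Perm (Fin (2 * l))) : cconj l (cconj l σ) = σ := by
  unfold cconj
  calc _ = (cswapPerm l * cswapPerm l) * σ * (cswapPerm l * cswapPerm l) := by group
    _ = σ := by simp [cswapPerm_mul_self]

lemma natFun_cconj {l x : ℕ} (σ : Equiv.Perm (Fin (2 * l))) (hx : x < 2 * l) :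
    natFun (cconj l σ) x = cswapFun l (natFun σ (cswapFun l x)) := by
  have h := cswapFun_lt l x hx
  rw [cconj, natFun_mul, natFun_mul, natFun_cswapPerm hx, natFun_cswapPerm (natFun_lt σ h)]

lemma natFun_cconj_of_add_two_le {l x : ℕ} (σ : Equiv.Perm (Fin (2 * l))) (hx : x + 2 ≤ l) :
    natFun (cconj l σ) x = cswapFun l (natFun σ x) := by
  rw [natFun_cconj σ (by omega), show cswapFun l x = x by unfold cswapFun; split_ifs <;> omega]

lemma natFun_cconj_sub_one {l : ℕ} (hl : 1 ≤ l) (σ : Equiv.Perm (Fin (2 * l))) :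
    natFun (cconj l σ) (l - 1) = cswapFun l (natFun σ l) := by
  rw [natFun_cconj σ (by omega), show cswapFun l (l - 1) = l by simp [cswapFun]]

lemma natFun_cconj_self {l : ℕ} (hl : 1 ≤ l) (σ : Equiv.Perm (Fin (2 * l))) :
    natFun (cconj l σ) l = cswapFun l (natFun σ (l - 1)) := by
  rw [natFun_cconj σ (by omega),
    show cswapFun l l = l - 1 by unfold cswapFun; split_ifs <;> omega]

lemma commutesRev_cswapPerm (l : ℕ) : CommutesRev l (cswapPerm l) := by
  refine commutesRev_iff.2 fun x hx => ?_
  rw [natFun_cswapPerm hx, natFun_cswapPerm (by omega)]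
  unfold cswapFun
  split_ifs <;> omega

lemma CommutesRev.cconj {l : ℕ} {σ : Equiv.Perm (Fin (2 * l))} (hσ : CommutesRev l σ) :
    CommutesRev l (cconj l σ) :=
  ((commutesRev_cswapPerm l).mul hσ).mul (commutesRev_cswapPerm l)

lemma even_signChanges_iff {l : ℕ} {σ : Equiv.Perm (Fin (2 * l))} :
    Even (signChanges l σ).card ↔
      ∑ i ∈ Finset.range l, (if l ≤ natFun σ i then (1 : ZMod 2) else 0) = 0 := by
  rw [Finset.sum_boole, ZMod.natCast_eq_zero_iff_even]
  rfl

lemma natFun_sub_one_eq_or {l : ℕ} (hl : 1 ≤ l) {σ : Equiv.Perm (Fin (2 * l))}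
    (hσ : CommutesRev l σ)
    (h : ∀ i, i + 2 ≤ l → natFun σ i ≠ l - 1 ∧ natFun σ i ≠ l) :
    natFun σ (l - 1) = l - 1 ∨ natFun σ (l - 1) = l := by
  have h1 := natFun_natFun_inv σ l
  have h2 := natFun_lt σ⁻¹ (show l < 2 * l by omega)
  set j := natFun σ⁻¹ l
  have h3 := commutesRev_iff.1 hσ j h2
  by_cases hj : j < l
  · have := h j
    rcases eq_or_ne j (l - 1) with hj' | hj'
    · rw [← hj']; exact Or.inr h1
    · omega
  · have := h (2 * l - 1 - j)
    rcases eq_or_ne j l with hj' | hj'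
    · rw [hj', show 2 * l - 1 - l = l - 1 by omega] at h3
      rw [hj'] at h1
      omega
    · omega

lemma sum_middle_eq_one {l : ℕ} (hl : 1 ≤ l) {σ : Equiv.Perm (Fin (2 * l))}
    (hσ : CommutesRev l σ) :
    ∑ i ∈ Finset.range l,
      (if natFun σ i = l - 1 ∨ natFun σ i = l then 1 else 0 : ZMod 2) = 1 := by
  have hex : ∃ j < l, natFun σ j = l - 1 ∨ natFun σ j = l := by
    by_contra! h
    have := natFun_sub_one_eq_or hl hσ fun i hi => h i (by omega)
    have := h (l - 1) (by omega)
    omega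
  obtain ⟨j, hj, hjv⟩ := hex
  rw [Finset.sum_eq_single_of_mem j (by simpa using hj), if_pos hjv]
  intro b hb hne
  rw [Finset.mem_range] at hb
  have h1 := natFun_add_ne hσ (x := b) (y := j) (by omega) (by omega) (by omega)
  have h2 := (natFun_injective σ).ne hne
  rw [if_neg (by omega)]

lemma inWeylD.cconj {l : ℕ} (hl : 1 ≤ l) {σ : Equiv.Perm (Fin (2 * l))} (hσ : inWeylD l σ) :
    inWeylD l (cconj l σ) := by
  rw [inWeylD_iff] at hσ ⊢
  obtain ⟨hc, he⟩ := hσ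
  refine ⟨hc.cconj, ?_⟩
  rw [even_signChanges_iff] at he ⊢
  refine Eq.trans ?_ he
  have hmid := sum_middle_eq_one hl hc
  obtain ⟨m, rfl⟩ : ∃ m, l = m + 1 := ⟨l - 1, by omega⟩
  rw [Finset.sum_range_succ] at hmid ⊢
  rw [Finset.sum_range_succ]
  have hstep : ∀ i ∈ Finset.range m,
      (if m + 1 ≤ natFun (_root_.cconj (m + 1) σ) i then (1 : ZMod 2) else 0) =
        (if m + 1 ≤ natFun σ i then 1 else 0) +
        (if natFun σ i = m + 1 - 1 ∨ natFun σ i = m + 1 then 1 else 0) := by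
    intro i hi
    rw [Finset.mem_range] at hi
    rw [natFun_cconj_of_add_two_le σ (by omega)]
    unfold cswapFun
    split_ifs <;> first | omega | rfl
  rw [Finset.sum_congr rfl hstep, Finset.sum_add_distrib, eq_sub_of_add_eq hmid]
  have h1 := natFun_cconj_sub_one (l := m + 1) (by omega) σ
  have h2 := commutesRev_iff.1 hc m (by omega)
  have h3 := natFun_lt σ (show m < 2 * (m + 1) by omega)
  rw [show m + 1 - 1 = m by omega] at h1
  rw [show 2 * (m + 1) - 1 - m = m + 1 by omega] at h2
  rw [h1, h2, add_assoc]
  congr 1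
  unfold cswapFun
  split_ifs <;> first | omega | decide

lemma negOrSimplePair_cswapFun {l x y : ℕ} (hl : 2 ≤ l)
    (hr : x + y ≠ 2 * l - 1) (h : negOrSimplePair l x y) :
    negOrSimplePair l (cswapFun l x) (cswapFun l y) := by
  unfold negOrSimplePair cswapFun at *
  split_ifs <;> omega

lemma inBesselD.cconj {l : ℕ} (hl : 2 ≤ l) {σ : Equiv.Perm (Fin (2 * l))}
    (hσ : inBesselD l σ) : inBesselD l (cconj l σ) := by
  rw [inBesselD_iff hl] at hσ ⊢
  obtain ⟨hW, h1, h2⟩ := hσ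
  have hc : CommutesRev l σ := hW.1
  have key {x y : ℕ} (hx : x < 2 * l) (hy : y < 2 * l) (hr : x + y ≠ 2 * l - 1) :=
    negOrSimplePair_cswapFun hl (natFun_add_ne hc hx hy hr)
  refine ⟨hW.cconj (by omega), fun k hk => ?_, ?_⟩
  · rw [natFun_cconj_of_add_two_le σ hk]
    rcases eq_or_ne (k + 2) l with hk' | hk'
    · rw [show k + 1 = l - 1 by omega, natFun_cconj_sub_one (by omega)]
      refine key (by omega) (by omega) (by omega) ?_
      rwa [show k = l - 2 by omega]
    · rw [natFun_cconj_of_add_two_le σ (by omega)]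
      exact key (by omega) (by omega) (by omega) (h1 k hk)
  · rw [natFun_cconj_of_add_two_le σ (by omega), natFun_cconj_self (by omega)]
    refine key (by omega) (by omega) (by omega) ?_
    have := h1 (l - 2) (by omega)
    rwa [show l - 2 + 1 = l - 1 by omega] at this

lemma cconj_eq_self {l : ℕ} (hl : 2 ≤ l) {σ : Equiv.Perm (Fin (2 * l))}
    (hσ : CommutesRev l σ) (h : natFun σ (l - 1) = l - 1 ∨ natFun σ (l - 1) = l) :
    cconj l σ = σ := by
  have hr := commutesRev_iff.1 hσ (l - 1) (by omega)
  rw [show 2 * l - 1 - (l - 1) = l by omega] at hr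
  refine perm_ext_natFun fun x hx => ?_
  rcases eq_or_ne x (l - 1) with rfl | h1
  · rw [natFun_cconj_sub_one (by omega), hr]
    unfold cswapFun
    split_ifs <;> omega
  rcases eq_or_ne x l with rfl | h2
  · rw [natFun_cconj_self (by omega), hr]
    unfold cswapFun
    split_ifs <;> omega
  rw [natFun_cconj σ hx, show cswapFun l x = x by simp [cswapFun, h1, h2]]
  have h3 := (natFun_injective σ).ne h1
  have h4 := (natFun_injective σ).ne h2
  unfold cswapFun
  split_ifs <;> omega

lemma exists_natFun_eq_of_cconj_ne {l : ℕ} (hl : 2 ≤ l) {σ : Equiv.Perm (Fin (2 * l))}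
    (hσ : CommutesRev l σ) (h : cconj l σ ≠ σ) :
    ∃ i, i + 2 ≤ l ∧ (natFun σ i = l - 1 ∨ natFun σ i = l) := by
  by_contra! hcon
  exact h (cconj_eq_self hl hσ (natFun_sub_one_eq_or (by omega) hσ hcon))

lemma bessel_dichotomy {l : ℕ} (hl : 2 ≤ l) {σ : Equiv.Perm (Fin (2 * l))}
    (hσ : inBesselD l σ) :
    (∀ i, i + 2 ≤ l → l - 1 ≤ natFun σ i) ∨
    ∃ n, n + 2 ≤ l ∧ (∀ i < n, 2 * l - n ≤ natFun σ i) ∧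
      (∀ i, n ≤ i → i + 2 ≤ l → natFun σ i = i) ∧
      (natFun σ (l - 1) = l - 1 ∨ natFun σ (l - 1) = l) := by
  rw [inBesselD_iff hl] at hσ
  obtain ⟨hW, h1, h2⟩ := hσ
  have hc : CommutesRev l σ := hW.1
  have hne {x y : ℕ} (hxy : x ≠ y) := (natFun_injective σ).ne hxy
  have hadd {x y : ℕ} (hx : x < 2 * l) (hy : y < 2 * l) (hr : x + y ≠ 2 * l - 1) :=
    natFun_add_ne hc hx hy hr
  have hlast := h1 (l - 2) (by omega)
  rw [show l - 2 + 1 = l - 1 by omega] at hlast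
  have hr := commutesRev_iff.1 hc (l - 1) (by omega)
  rw [show 2 * l - 1 - (l - 1) = l by omega] at hr
  have hltl := natFun_lt σ (show l - 1 < 2 * l by omega)
  unfold negOrSimplePair at h1 h2 hlast
  refine or_iff_not_imp_left.2 fun hA => ?_
  push Not at hA
  obtain ⟨hend, hend'⟩ : natFun σ (l - 2) = l - 2 ∧
      (natFun σ (l - 1) = l - 1 ∨ natFun σ (l - 1) = l) := by
    suffices h : natFun σ (l - 2) < l - 1 by
      have := hne (show l - 2 ≠ l - 1 by omega)
      omega
    by_contra hge
    have hex : ∃ i, i + 3 ≤ l ∧ natFun σ i < l - 1 ∧ l - 1 ≤ natFun σ (i + 1) := by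
      obtain ⟨i, hi, hil⟩ := hA
      by_contra! hcon
      have : ∀ d, i + d + 2 ≤ l → natFun σ (i + d) < l - 1 := by
        intro d
        induction d with
        | zero => exact fun _ => hil
        | succ d ih => exact fun hd => hcon (i + d) (by omega) (ih (by omega))
      have := this (l - 2 - i) (by omega)
      rw [show i + (l - 2 - i) = l - 2 by omega] at this
      omega
    have hmax : ∃ i, i + 3 ≤ l ∧ natFun σ i < l - 1 ∧
        ∀ j, i < j → j + 2 ≤ l → l - 1 ≤ natFun σ j := by
      classical
      let P : ℕ → Prop := fun i => natFun σ i < l - 1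
      obtain ⟨i, hi, hil, -⟩ := hex
      have hP : P (Nat.findGreatest P (l - 2)) :=
        Nat.findGreatest_spec (show i ≤ l - 2 by omega) hil
      have hle := Nat.findGreatest_le (P := P) (l - 2)
      refine ⟨Nat.findGreatest P (l - 2), ?_, hP, fun j hj hjl => ?_⟩
      · rcases eq_or_ne (Nat.findGreatest P (l - 2)) (l - 2) with h | h
        · rw [h] at hP
          exact absurd hP hge
        · omega
      · have : ¬ P j := Nat.findGreatest_is_greatest hj (by omega)
        exact not_lt.1 this
    obtain ⟨i, hi, hil, hgt⟩ := hmax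
    have a1 := h1 i (by omega)
    have a2 := hgt (i + 1) (by omega) (by omega)
    have a3 := hne (show i ≠ i + 1 by omega)
    rcases eq_or_ne (i + 3) l with h3 | h3
    · rw [show l - 2 = i + 1 by omega] at hlast h2
      have b1 := hne (show i ≠ l - 1 by omega)
      have b2 := hadd (show i < 2 * l by omega) (show l - 1 < 2 * l by omega) (by omega)
      have b3 := hne (show i + 1 ≠ l - 1 by omega)
      have b4 := hadd (show i + 1 < 2 * l by omega) (show l - 1 < 2 * l by omega) (by omega)
      omega
    · have c1 := h1 (i + 1) (by omega)
      have c2 := hgt (i + 2) (by omega) (by omega)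
      have b1 := hne (show i ≠ i + 2 by omega)
      have b2 := hadd (show i < 2 * l by omega) (show i + 2 < 2 * l by omega) (by omega)
      have b3 := hne (show i + 1 ≠ i + 2 by omega)
      have b4 := hadd (show i + 1 < 2 * l by omega) (show i + 2 < 2 * l by omega) (by omega)
      rw [show i + 1 + 1 = i + 2 by omega] at c1
      omega
  classical
  have hexn : ∃ n, n + 2 ≤ l ∧ ∀ i, n ≤ i → i + 2 ≤ l → natFun σ i = i := by
    refine ⟨l - 2, by omega, fun i hi hi' => ?_⟩
    rwa [show i = l - 2 by omega]
  obtain ⟨hn, hfix⟩ := Nat.find_spec hexn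
  have hmin := fun m => Nat.find_min hexn (m := m)
  set n := Nat.find hexn
  refine ⟨n, hn, ?_, hfix, hend'⟩
  rcases Nat.eq_zero_or_pos n with h0 | hpos
  · intro i hi
    omega
  have hprev : natFun σ (n - 1) ≠ n - 1 := by
    intro h
    refine hmin (n - 1) (by omega) ⟨by omega, fun i hi hi' => ?_⟩
    rcases eq_or_ne i (n - 1) with rfl | hin
    · exact h
    · exact hfix i (by omega) hi'
  have hout : ∀ i < n, natFun σ i < n ∨ 2 * l - n ≤ natFun σ i := by
    intro i hi
    by_contra! hcon
    have a1 := hne (show i ≠ l - 1 by omega)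
    have a2 := hadd (show i < 2 * l by omega) (show l - 1 < 2 * l by omega) (by omega)
    by_cases hlt : natFun σ i + 2 ≤ l
    · have := hfix _ hcon.1 hlt
      have := natFun_injective σ this
      omega
    · by_cases hgt : l + 1 ≤ natFun σ i
      · have := hfix (2 * l - 1 - natFun σ i) (by omega) (by omega)
        have := hadd (show i < 2 * l by omega)
          (show 2 * l - 1 - natFun σ i < 2 * l by omega) (by omega)
        omega
      · omega
  have hdown : ∀ d, d + 1 ≤ n → 2 * l - n ≤ natFun σ (n - 1 - d) := by
    intro d
    induction d with
    | zero =>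
      intro _
      have a1 := h1 (n - 1) (by omega)
      rw [show n - 1 + 1 = n by omega, hfix n le_rfl hn] at a1
      have := hout (n - 1) (by omega)
      rw [Nat.sub_zero]
      omega
    | succ d ih =>
      intro hd
      have a1 := h1 (n - 1 - (d + 1)) (by omega)
      rw [show n - 1 - (d + 1) + 1 = n - 1 - d by omega] at a1
      have := ih (by omega)
      have := hout (n - 1 - (d + 1)) (by omega)
      omega
  intro i hi
  have := hdown (n - 1 - i) (by omega)
  rwa [show n - 1 - (n - 1 - i) = i by omega] at this

lemma isGLnBlock_iff {l n : ℕ} {τ : Equiv.Perm (Fin (2 * l))} :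
    isGLnBlock l n τ ↔ (∀ x < 2 * l, x < n → natFun τ x < n) ∧
      (∀ x, n ≤ x → x < 2 * l - n → natFun τ x = x) ∧ CommutesRev l τ := by
  unfold isGLnBlock CommutesRev
  refine and_congr ?_ (and_congr ?_ Iff.rfl)
  · constructor
    · intro h x hx hxn
      simpa [natFun, hx] using h ⟨x, hx⟩ hxn
    · intro h i hi
      rw [← natFun_val]
      exact h i i.isLt hi
  · constructor
    · intro h x hx hxn
      have := h ⟨x, by omega⟩ hx hxn
      simp [natFun, this]
    · intro h i hi hin
      apply Fin.ext
      rw [← natFun_val]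
      exact h i hi hin

lemma natFun_wtnPerm {l n x : ℕ} (hn : n + 1 ≤ l) (hx : x < 2 * l) :
    natFun (wtnPerm l n) x = wtnFun l n x := by
  rw [wtnPerm, dif_pos hn, natFun_natPerm _ _ _ hx]

lemma commutesRev_wtnPerm {l n : ℕ} (hn : n + 1 ≤ l) : CommutesRev l (wtnPerm l n) := by
  refine commutesRev_iff.2 fun x hx => ?_
  rw [natFun_wtnPerm hn hx, natFun_wtnPerm hn (by omega)]
  unfold wtnFun
  split_ifs <;> omega

lemma wtnPerm_mul_self {l n : ℕ} (hn : n + 1 ≤ l) : wtnPerm l n * wtnPerm l n = 1 := by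
  refine perm_ext_natFun fun x hx => ?_
  rw [natFun_mul, natFun_wtnPerm hn hx, natFun_wtnPerm hn (wtnFun_lt l n hn x hx),
    wtnFun_invol l n hn x hx, natFun_one]

lemma natFun_block_mul_wtnPerm {l n : ℕ} (hn : n + 2 ≤ l) {τ : Equiv.Perm (Fin (2 * l))}
    (hτ : isGLnBlock l n τ) :
    (∀ i < n, 2 * l - n ≤ natFun (τ * wtnPerm l n) i) ∧
      ∀ i, n ≤ i → i + 2 ≤ l → natFun (τ * wtnPerm l n) i = i := by
  obtain ⟨h1, h2, h3⟩ := isGLnBlock_iff.1 hτ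
  refine ⟨fun i hi => ?_, fun i hi hi' => ?_⟩
  · rw [natFun_mul, natFun_wtnPerm (by omega) (by omega), wtnFun, if_pos hi]
    have := commutesRev_iff.1 h3 (n - 1 - i) (by omega)
    rw [show 2 * l - 1 - (n - 1 - i) = i + (2 * l - n) by omega] at this
    have := h1 (n - 1 - i) (by omega) (by omega)
    omega
  · rw [natFun_mul, natFun_wtnPerm (by omega) (by omega),
      show wtnFun l n i = i by unfold wtnFun; split_ifs <;> omega]
    exact h2 i hi (by omega)

lemma exists_block_mul_wtnPerm {l n : ℕ} (hn : n + 2 ≤ l) {σ : Equiv.Perm (Fin (2 * l))}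
    (hσ : inWeylD l σ) (h1 : ∀ i < n, 2 * l - n ≤ natFun σ i)
    (h2 : ∀ i, n ≤ i → i + 2 ≤ l → natFun σ i = i)
    (h3 : natFun σ (l - 1) = l - 1 ∨ natFun σ (l - 1) = l) :
    ∃ τ, isGLnBlock l n τ ∧ σ = τ * wtnPerm l n := by
  obtain ⟨hc, he⟩ := inWeylD_iff.1 hσ
  have hodd := le_natFun_iff_odd (n := n) (by omega) he
    (fun i hi => by have := h1 i hi; omega) (fun i hi hi' => by have := h2 i hi hi'; omega)
  have hmid := commutesRev_iff.1 hc (l - 1) (by omega)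
  rw [show 2 * l - 1 - (l - 1) = l by omega] at hmid
  refine ⟨σ * wtnPerm l n, isGLnBlock_iff.2 ⟨fun x hx hxn => ?_, fun x hx hxn => ?_,
    hc.mul (commutesRev_wtnPerm (by omega))⟩, ?_⟩
  · rw [natFun_mul, natFun_wtnPerm (by omega) hx, wtnFun, if_pos hxn]
    have := commutesRev_iff.1 hc (n - 1 - x) (by omega)
    rw [show 2 * l - 1 - (n - 1 - x) = x + (2 * l - n) by omega] at this
    have := h1 (n - 1 - x) (by omega)
    omega
  · rw [natFun_mul, natFun_wtnPerm (by omega) (by omega), wtnFun, if_neg (by omega),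
      if_neg (by omega)]
    split_ifs with ho ho'
    · omega
    · omega
    · rcases lt_trichotomy x (l - 1) with hlt | rfl | hgt
      · exact h2 x hx (by omega)
      · omega
      · rcases eq_or_ne x l with rfl | hne
        · omega
        · have a1 := h2 (2 * l - 1 - x) (by omega) (by omega)
          have a2 := commutesRev_iff.1 hc x (by omega)
          have a3 := natFun_lt σ (show x < 2 * l by omega)
          omega
  · rw [mul_assoc, wtnPerm_mul_self (by omega), mul_one]

lemma natFun_wtlPerm {l x : ℕ} (hx : x < 2 * l) :
    natFun (wtlPerm l) x =
      if l % 2 = 1 then cswapFun l (shFun l (endSwapFun l (cswapFun l x))) else shFun l x := by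
  unfold wtlPerm
  split_ifs
  · have a1 := cswapFun_lt l x hx
    have a2 := endSwapFun_lt l _ a1
    rw [natFun_mul, natFun_mul, natFun_mul, natFun_cswapPerm hx, endSwapPerm,
      natFun_natPerm _ _ _ a1, shPerm, natFun_natPerm _ _ _ a2,
      natFun_cswapPerm (shFun_lt l _ a2)]
  · rw [shPerm, natFun_natPerm _ _ _ hx]

lemma commutesRev_wtlPerm (l : ℕ) : CommutesRev l (wtlPerm l) := by
  have hend : CommutesRev l (endSwapPerm l) := by
    refine commutesRev_iff.2 fun x hx => ?_
    rw [endSwapPerm, natFun_natPerm _ _ _ hx, natFun_natPerm _ _ _ (by omega)]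
    unfold endSwapFun
    split_ifs <;> omega
  have hsh : CommutesRev l (shPerm l) := by
    refine commutesRev_iff.2 fun x hx => ?_
    rw [shPerm, natFun_natPerm _ _ _ hx, natFun_natPerm _ _ _ (by omega)]
    unfold shFun
    split_ifs <;> omega
  unfold wtlPerm
  split_ifs
  · exact ((commutesRev_cswapPerm l).mul (hsh.mul hend)).mul (commutesRev_cswapPerm l)
  · exact hsh

lemma le_natFun_wtlPerm_iff {l x : ℕ} (hl : 2 ≤ l) (hx : x < 2 * l) :
    l ≤ natFun (wtlPerm l) x ↔ x + 1 < l ∨ (l % 2 = 0 ∧ x + 1 = l) ∨ (l % 2 = 1 ∧ x = l) := by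
  rw [natFun_wtlPerm hx]
  unfold cswapFun shFun endSwapFun
  split_ifs <;> omega

lemma le_natFun_block_mul_wtlPerm {l : ℕ} (hl : 2 ≤ l) {τ : Equiv.Perm (Fin (2 * l))}
    (hτ : isGLnBlock l l τ) (i : ℕ) (hi : i + 2 ≤ l) : l ≤ natFun (τ * wtlPerm l) i := by
  obtain ⟨h1, -, h3⟩ := isGLnBlock_iff.1 hτ
  rw [natFun_mul]
  have a1 := (le_natFun_wtlPerm_iff hl (show i < 2 * l by omega)).2 (by omega)
  have a2 := natFun_lt (wtlPerm l) (show i < 2 * l by omega)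
  have a3 := commutesRev_iff.1 h3 _ a2
  have a4 := h1 (2 * l - 1 - natFun (wtlPerm l) i) (by omega) (by omega)
  omega

lemma exists_block_mul_wtlPerm {l : ℕ} (hl : 2 ≤ l) {σ : Equiv.Perm (Fin (2 * l))}
    (hσ : inWeylD l σ) (h : ∀ i, i + 2 ≤ l → l ≤ natFun σ i) :
    ∃ τ, isGLnBlock l l τ ∧ σ = τ * wtlPerm l := by
  obtain ⟨hc, he⟩ := inWeylD_iff.1 hσ
  have hodd := le_natFun_iff_odd (n := l - 1) (by omega) he
    (fun i hi => h i (by omega)) (fun i hi hi' => by omega)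
  have hmid := commutesRev_iff.1 hc (l - 1) (by omega)
  rw [show 2 * l - 1 - (l - 1) = l by omega] at hmid
  refine ⟨σ * (wtlPerm l)⁻¹, isGLnBlock_iff.2 ⟨fun x hx hxn => ?_, fun x hx hxn => by omega,
    hc.mul (commutesRev_wtlPerm l).inv⟩, by simp⟩
  rw [natFun_mul]
  have a1 := natFun_lt (wtlPerm l)⁻¹ hx
  have a2 := le_natFun_wtlPerm_iff hl a1
  rw [natFun_natFun_inv] at a2
  set j := natFun (wtlPerm l)⁻¹ x
  rcases lt_trichotomy j (l - 1) with hlt | heq | hgt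
  · omega
  · rw [heq] at a2 ⊢
    omega
  · rcases eq_or_ne j l with heq | hne
    · rw [heq] at a2 ⊢
      omega
    · have b1 := commutesRev_iff.1 hc j a1
      have b2 := h (2 * l - 1 - j) (by omega)
      omega

lemma inBesselD.commutesRev {l : ℕ} {σ : Equiv.Perm (Fin (2 * l))} (hσ : inBesselD l σ) :
    CommutesRev l σ :=
  hσ.1.1

section besselClass

variable {l : ℕ} {σ : Equiv.Perm (Fin (2 * l))}

lemma mem_besselClass_of_add_two_le {n : ℕ} (hn : n + 2 ≤ l) :
    σ ∈ besselClass l n ↔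
      inBesselD l σ ∧ ∃ τ, isGLnBlock l n τ ∧ σ = τ * wtnPerm l n := by
  rw [besselClass, if_pos (by omega)]
  rfl

lemma mem_besselClass_sub_one (hl : 2 ≤ l) :
    σ ∈ besselClass l (l - 1) ↔
      inBesselD l σ ∧ (∀ i, i + 2 ≤ l → l ≤ natFun σ i) ∧ cconj l σ = σ := by
  rw [besselClass, if_neg (by omega), if_pos rfl]
  refine and_congr_right fun hB => and_congr ⟨?_, exists_block_mul_wtlPerm hl hB.1⟩ Iff.rfl
  rintro ⟨τ, hτ, rfl⟩
  exact le_natFun_block_mul_wtlPerm hl hτ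

lemma mem_besselClass_self (hl : 2 ≤ l) :
    σ ∈ besselClass l l ↔
      inBesselD l σ ∧ (∀ i, i + 2 ≤ l → l ≤ natFun σ i) ∧ cconj l σ ≠ σ := by
  rw [besselClass, if_neg (by omega), if_neg (by omega), if_pos rfl]
  refine and_congr_right fun hB => and_congr ⟨?_, exists_block_mul_wtlPerm hl hB.1⟩ Iff.rfl
  rintro ⟨τ, hτ, rfl⟩
  exact le_natFun_block_mul_wtlPerm hl hτ

lemma mem_besselClass_add_one (hl : 2 ≤ l) :
    σ ∈ besselClass l (l + 1) ↔ cconj l σ ∈ besselClass l l := by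
  have h : σ ∈ besselClass l (l + 1) ↔ ∃ σ' ∈ besselClass l l, σ = cconj l σ' := by
    simp only [besselClass, if_neg (show ¬ l + 1 ≤ l - 2 by omega),
      if_neg (show ¬ l + 1 = l - 1 by omega), if_neg (show ¬ l + 1 = l by omega),
      if_neg (show ¬ l ≤ l - 2 by omega), if_neg (show ¬ l = l - 1 by omega), if_true]
    rfl
  rw [h]
  constructor
  · rintro ⟨σ', h', rfl⟩
    rwa [cconj_cconj]
  · exact fun h' => ⟨_, h', (cconj_cconj l σ).symm⟩

lemma natFun_of_mem_besselClass {n : ℕ} (hn : n + 2 ≤ l) (h : σ ∈ besselClass l n) :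
    (∀ i < n, 2 * l - n ≤ natFun σ i) ∧ natFun σ n = n := by
  obtain ⟨-, τ, hτ, rfl⟩ := (mem_besselClass_of_add_two_le hn).1 h
  obtain ⟨h1, h2⟩ := natFun_block_mul_wtnPerm hn hτ
  exact ⟨h1, h2 n le_rfl hn⟩

lemma le_natFun_of_mem_besselClass (hl : 2 ≤ l) {a : ℕ} (ha : l ≤ a + 1) (ha' : a < l + 2)
    (h : σ ∈ besselClass l a) (i : ℕ) (hi : i + 2 ≤ l) : l - 1 ≤ natFun σ i := by
  obtain rfl | rfl | rfl : a = l - 1 ∨ a = l ∨ a = l + 1 := by omega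
  · have := ((mem_besselClass_sub_one hl).1 h).2.1 i hi
    omega
  · have := ((mem_besselClass_self hl).1 h).2.1 i hi
    omega
  · have := ((mem_besselClass_self hl).1 ((mem_besselClass_add_one hl).1 h)).2.1 i hi
    rw [natFun_cconj_of_add_two_le σ hi] at this
    unfold cswapFun at this
    split_ifs at this <;> omega

lemma not_mem_of_mem_besselClass_add_one (hl : 2 ≤ l) (h : σ ∈ besselClass l (l + 1)) :
    σ ∉ besselClass l l := by
  intro h'
  obtain ⟨hB, h1, hne⟩ := (mem_besselClass_self hl).1 h'
  obtain ⟨-, h2, -⟩ := (mem_besselClass_self hl).1 ((mem_besselClass_add_one hl).1 h)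
  obtain ⟨i, hi, hv⟩ := exists_natFun_eq_of_cconj_ne hl hB.commutesRev hne
  have a1 := h1 i hi
  have a2 := h2 i hi
  rw [natFun_cconj_of_add_two_le σ hi] at a2
  unfold cswapFun at a2
  split_ifs at a2 <;> omega

lemma inBesselD_of_mem_besselClass (hl : 2 ≤ l) {a : ℕ} (ha : a < l + 2)
    (h : σ ∈ besselClass l a) : inBesselD l σ := by
  obtain ha' | rfl | rfl | rfl : a + 2 ≤ l ∨ a = l - 1 ∨ a = l ∨ a = l + 1 := by omega
  · exact ((mem_besselClass_of_add_two_le ha').1 h).1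
  · exact ((mem_besselClass_sub_one hl).1 h).1
  · exact ((mem_besselClass_self hl).1 h).1
  · rw [← cconj_cconj l σ]
    exact ((mem_besselClass_self hl).1 ((mem_besselClass_add_one hl).1 h)).1.cconj hl

lemma exists_mem_besselClass (hl : 2 ≤ l) (h : inBesselD l σ) :
    ∃ a < l + 2, σ ∈ besselClass l a := by
  rcases bessel_dichotomy hl h with hA | ⟨n, hn, h1, h2, h3⟩
  · by_cases hA' : ∀ i, i + 2 ≤ l → l ≤ natFun σ i
    · by_cases hcc : cconj l σ = σ
      · exact ⟨l - 1, by omega, (mem_besselClass_sub_one hl).2 ⟨h, hA', hcc⟩⟩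
      · exact ⟨l, by omega, (mem_besselClass_self hl).2 ⟨h, hA', hcc⟩⟩
    · push Not at hA'
      obtain ⟨j, hj, hjl⟩ := hA'
      have hjv := hA j hj
      refine ⟨l + 1, by omega, (mem_besselClass_add_one hl).2
        ((mem_besselClass_self hl).2 ⟨h.cconj hl, fun i hi => ?_, ?_⟩)⟩
      · have a1 := hA i hi
        have a2 := natFun_add_ne h.commutesRev (x := i) (y := j) (by omega) (by omega) (by omega)
        rw [natFun_cconj_of_add_two_le σ hi]
        unfold cswapFun
        split_ifs <;> omega
      · rw [cconj_cconj]
        intro heq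
        have a1 := natFun_cconj_of_add_two_le σ hj
        rw [← heq] at a1
        unfold cswapFun at a1
        split_ifs at a1 <;> omega
  · exact ⟨n, by omega, (mem_besselClass_of_add_two_le hn).2
      ⟨h, exists_block_mul_wtnPerm hn h.1 h1 h2 h3⟩⟩

lemma not_mem_besselClass_of_lt (hl : 2 ≤ l) {a b : ℕ} (hab : a < b) (hb : b < l + 2)
    (ha : σ ∈ besselClass l a) : σ ∉ besselClass l b := by
  intro hb'
  by_cases ha2 : a + 2 ≤ l
  · have a1 := (natFun_of_mem_besselClass ha2 ha).2
    by_cases hb2 : b + 2 ≤ l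
    · have := (natFun_of_mem_besselClass hb2 hb').1 a hab
      omega
    · have := le_natFun_of_mem_besselClass hl (by omega) hb hb' a ha2
      omega
  · obtain ⟨rfl, rfl⟩ | ⟨rfl, rfl⟩ | ⟨rfl, rfl⟩ :
        (a = l - 1 ∧ b = l) ∨ (a = l - 1 ∧ b = l + 1) ∨ (a = l ∧ b = l + 1) := by omega
    · exact ((mem_besselClass_self hl).1 hb').2.2 ((mem_besselClass_sub_one hl).1 ha).2.2
    · have hcc := ((mem_besselClass_sub_one hl).1 ha).2.2
      have h1 := (mem_besselClass_add_one hl).1 hb'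
      rw [hcc] at h1
      exact not_mem_of_mem_besselClass_add_one hl hb' h1
    · exact not_mem_of_mem_besselClass_add_one hl hb' ha

end besselClass

/-- the sets `B_0, …, B_l` together with `B_l^c` form a partition of the
Bessel support `B(SO_{2l})`. -/
theorem statement13 (l : ℕ) (hl : 2 ≤ l) :
    (⋃ idx ∈ Finset.range (l+2), besselClass l idx) = {σ | inBesselD l σ} ∧
    ∀ a b : ℕ, a < l + 2 → b < l + 2 → a ≠ b →
      Disjoint (besselClass l a) (besselClass l b) := by
  refine ⟨?_, fun a b ha hb hab => Set.disjoint_left.2 fun σ h1 h2 => ?_⟩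
  · ext σ
    simp only [Set.mem_iUnion, Finset.mem_range, exists_prop, Set.mem_ofPred_eq]
    exact ⟨fun ⟨_, ha, h⟩ => inBesselD_of_mem_besselClass hl ha h, exists_mem_besselClass hl⟩
  · rcases lt_or_gt_of_ne hab with h | h
    · exact not_mem_besselClass_of_lt hl h hb h1 h2
    · exact not_mem_besselClass_of_lt hl h ha h2 h1

end
end
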